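/- Let k be an algebraically closed field of characteristic p > 0 (any p). Let f, g ∈ k[X₀,X₁,X₂,X₃] be homogeneous of degree 2 such that f and g have a common zero in k⁴ ∖ {0}, and at every common zero a ∈ k⁴ ∖ {0} the gradient vectors of f and of g at a are linearly independent over k. Set R = k[X₀,X₁,X₂,X₃]/(f,g). Then the Hilbert–Kunz multiplicity of the maximal ideal (X₀,X₁,X₂,X₃) exists and equals 8/3; that is, lim_{e→∞} dim_k( R/(X₀^{p^e}, X₁^{p^e}, X₂^{p^e}, X₃^{p^e}) ) / p^{2e} = 8/3. -/

import Mathlib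

/-- The syzygy step: a relation between `Z⁴, Z²UV, ZV³, U²V²` over a cubic ring descends to a
conic in `U, V` with smaller coefficients. -/
theorem exists_conic_of_syzygy {R : Type*} [CommRing R] [IsDomain R] {Z U V A₁ A₃ : R}
    (hrel : U ^ 3 = V ^ 3 + A₁ * U * V * Z + A₃ * Z ^ 3)
    (hZ : Z ≠ 0) (hV : V ≠ 0)
    (hZU : ∀ y, Z ∣ U * y → Z ∣ y) (hZV : ∀ y, Z ∣ V * y → Z ∣ y)
    (hVZ : ∀ y, V ∣ Z * y → V ∣ y) (hVU : ∀ y, V ∣ U * y → V ∣ y)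
    {b₀ b₁ b₂ b₃ : R}
    (hb : b₀ * Z ^ 4 + b₁ * (Z ^ 2 * U * V) + b₂ * (Z * V ^ 3) + b₃ * (U ^ 2 * V ^ 2) = 0) :
    ∃ M N K G, b₃ = Z * M ∧ b₀ = V * N ∧ Z * G = b₂ * V + M * U ^ 2 ∧
      b₁ * U + G * V + N * Z ^ 2 = 0 ∧
      N * V ^ 2 - K * (U * V) + A₃ * M * U ^ 2 = A₃ * G * Z := by
  obtain ⟨M, rfl⟩ : Z ∣ b₃ := by
    refine hZU _ (hZU _ (hZV _ (hZV _ ⟨-(b₀ * Z ^ 3 + b₁ * (Z * U * V) + b₂ * V ^ 3), ?_⟩)))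
    linear_combination hb
  have h1 : b₀ * Z ^ 3 + b₁ * (Z * U * V) + b₂ * V ^ 3 + M * (U ^ 2 * V ^ 2) = 0 := by
    apply mul_left_cancel₀ hZ; linear_combination hb
  obtain ⟨N, rfl⟩ : V ∣ b₀ := by
    refine hVZ _ (hVZ _ (hVZ _ ⟨-(b₁ * (Z * U) + b₂ * V ^ 2 + M * (U ^ 2 * V)), ?_⟩))
    linear_combination h1
  have h2 : N * Z ^ 3 + b₁ * (Z * U) + b₂ * V ^ 2 + M * (U ^ 2 * V) = 0 := by
    apply mul_left_cancel₀ hV; linear_combination h1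
  obtain ⟨G, hG⟩ : Z ∣ b₂ * V + M * U ^ 2 := by
    refine hZV _ ⟨-(N * Z ^ 2 + b₁ * U), ?_⟩
    linear_combination h2
  have h3 : b₁ * U + G * V + N * Z ^ 2 = 0 := by
    apply mul_left_cancel₀ hZ; linear_combination h2 - V * hG
  obtain ⟨H, hH⟩ : V ∣ A₃ * b₁ * Z + N * U ^ 2 - A₁ * N * V * Z := by
    refine hVU _ ⟨N * V ^ 2 - A₃ * G * Z, ?_⟩
    linear_combination A₃ * Z * h3 + N * hrel
  have h4 : U * H = N * V ^ 2 - A₃ * G * Z := by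
    apply mul_left_cancel₀ hV; linear_combination A₃ * Z * h3 + N * hrel - U * hH
  obtain ⟨K, hK⟩ : V ∣ A₃ * M * U + H := by
    refine hVU _ ⟨N * V - A₃ * b₂, ?_⟩
    linear_combination h4 + A₃ * hG
  exact ⟨M, N, K, G, rfl, rfl, hG.symm, h3, by linear_combination U * hK - h4⟩

/-- If `x` has weight `c - a` for a coaction `φ` and `c < a`, then `x = 0`. -/
theorem eq_zero_of_coaction {R : Type*} [CommRing R] (φ : R →+* Polynomial R) {a c : ℕ}
    (hac : c < a) {x : R}
    (hx : φ x * Polynomial.X ^ a = Polynomial.C x * Polynomial.X ^ c) : x = 0 := by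
  have := congrArg (fun P => Polynomial.coeff P c) hx
  simpa [Polynomial.coeff_mul_X_pow', hac.not_ge] using this.symm

open Polynomial in
/-- The core vanishing statement on the plane cubic `u³ = v³ + a₁uvz + a₃z³`. -/
theorem coeffs_eq_zero_of_syzygy {R : Type*} [CommRing R] [IsDomain R] {Z U V A₁ A₃ : R}
    (hrel : U ^ 3 = V ^ 3 + A₁ * U * V * Z + A₃ * Z ^ 3)
    (hZ : Z ≠ 0) (hU : U ≠ 0) (hV : V ≠ 0) (hA₃ : A₃ ≠ 0)
    (hZU : ∀ y, Z ∣ U * y → Z ∣ y) (hZV : ∀ y, Z ∣ V * y → Z ∣ y)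
    (hVZ : ∀ y, V ∣ Z * y → V ∣ y) (hVU : ∀ y, V ∣ U * y → V ∣ y)
    (h3 : IsUnit (3 : R))
    {q m : ℕ} (hm : 3 * m < 4 * q)
    (φ : R →+* R[X]) (hφZ : φ Z = C Z * X ^ q) (hφU : φ U = C U * X ^ q)
    (hφV : φ V = C V * X ^ q) (hφA : φ A₃ = C A₃)
    (σ : R →+* R) {η : R} (hη : η ^ 2 + η + 1 = 0) (hση : σ η = η)
    (hσZ : σ Z = Z) (hσU : σ U = η ^ 2 * U) (hσV : σ V = η * V) (hσA : σ A₃ = A₃)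
    (hφη : φ η = C η)
    {b₀ b₁ b₂ b₃ : R}
    (hφ₀ : φ b₀ = C b₀ * X ^ m) (hφ₂ : φ b₂ = C b₂ * X ^ m) (hφ₃ : φ b₃ = C b₃ * X ^ m)
    (hσ₀ : σ b₀ = b₀) (hσ₂ : σ b₂ = b₂) (hσ₃ : σ b₃ = b₃)
    (hb : b₀ * Z ^ 4 + b₁ * (Z ^ 2 * U * V) + b₂ * (Z * V ^ 3) + b₃ * (U ^ 2 * V ^ 2) = 0) :
    b₀ = 0 ∧ b₁ = 0 ∧ b₂ = 0 ∧ b₃ = 0 := by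
  obtain ⟨M, N, K, G, rfl, rfl, hG, h1, hc⟩ :=
    exists_conic_of_syzygy hrel hZ hV hZU hZV hVZ hVU hb
  have hη3 : η ^ 3 = 1 := by linear_combination (η - 1) * hη
  have h3' : (3 : R) ≠ 0 := h3.ne_zero
  have hCZ : (C Z : R[X]) ≠ 0 := by simpa using hZ
  have hCV : (C V : R[X]) ≠ 0 := by simpa using hV
  have hCU : (C U : R[X]) ≠ 0 := by simpa using hU
  have wM : φ M * X ^ q = C M * X ^ m := by
    apply mul_left_cancel₀ hCZ
    simp only [map_mul, hφZ] at hφ₃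
    linear_combination hφ₃
  have wN : φ N * X ^ q = C N * X ^ m := by
    apply mul_left_cancel₀ hCV
    simp only [map_mul, hφV] at hφ₀
    linear_combination hφ₀
  have wG : φ G = C G * X ^ m := by
    have hX : (C Z * X ^ q : R[X]) ≠ 0 := mul_ne_zero hCZ (pow_ne_zero _ X_ne_zero)
    apply mul_left_cancel₀ hX
    have e1 := congrArg φ hG
    have e2 := congrArg (C : R →+* R[X]) hG
    simp only [map_mul, map_add, map_pow, hφZ, hφV, hφU, hφ₂] at e1 e2
    linear_combination e1 - X ^ q * X ^ m * e2 + C U ^ 2 * X ^ q * wM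
  have wK : φ K * X ^ q = C K * X ^ m := by
    have hX : (C U * C V * X ^ q : R[X]) ≠ 0 :=
      mul_ne_zero (mul_ne_zero hCU hCV) (pow_ne_zero _ X_ne_zero)
    apply mul_left_cancel₀ hX
    have e1 := congrArg φ hc
    have e2 := congrArg (C : R →+* R[X]) hc
    simp only [map_mul, map_add, map_sub, map_pow, hφZ, hφV, hφU, hφA, wG] at e1 e2
    linear_combination - e1 + X ^ q * X ^ m * e2 + C V ^ 2 * X ^ q * wN
      + C A₃ * C U ^ 2 * X ^ q * wM
  have sM : σ M = M := by
    apply mul_left_cancel₀ hZ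
    simpa [hσZ] using hσ₃
  have sN : η * σ N = N := by
    apply mul_left_cancel₀ hV
    simp only [map_mul, hσV] at hσ₀
    linear_combination hσ₀
  have sG : σ G = η * G := by
    apply mul_left_cancel₀ hZ
    have e1 := congrArg σ hG
    simp only [map_mul, map_add, map_pow, hσZ, hσV, hσU, hσ₂, sM] at e1
    linear_combination e1 - η * hG + M * U ^ 2 * η * hη3
  have sK : σ K = η * K := by
    apply mul_left_cancel₀ (mul_ne_zero hU hV)
    have e1 := congrArg σ hc
    simp only [map_mul, map_add, map_sub, map_pow, hσZ, hσV, hσU, hσA, sM, sG] at e1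
    linear_combination -e1 + η * hc + η * V ^ 2 * sN +
      (A₃ * M * U ^ 2 * η - σ K * U * V) * hη3
  let L : R → R := fun ζ => N - ζ * K + ζ ^ 2 * (A₃ * M)
  have hL : ∀ ζ : R, ζ ^ 3 = 1 → Z ∣ L ζ * (U ^ 2 + ζ * U * V + ζ ^ 2 * V ^ 2) := by
    intro ζ hζ
    refine hZV _ (hZV _ ⟨(U ^ 2 + ζ * U * V + ζ ^ 2 * V ^ 2) * (A₃ * G) -
      (A₁ * U * V + A₃ * Z ^ 2) * (-K * V + A₃ * M * (U + ζ * V)), ?_⟩)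
    simp only [L]
    linear_combination (U ^ 2 + ζ * U * V + ζ ^ 2 * V ^ 2) * hc -
      (-K * V + A₃ * M * (U + ζ * V)) * (hrel - V ^ 3 * hζ)
  have sL : ∀ ζ : R, ζ ^ 3 = 1 → σ ζ = ζ → η * σ (L ζ) = L (ζ * η ^ 2) := by
    intro ζ hζ hs
    simp only [L, map_add, map_sub, map_mul, map_pow, hs, sK, sM, hσA]
    linear_combination sN - ζ ^ 2 * A₃ * M * η * hη3
  have wL : ∀ ζ : R, φ ζ = C ζ → φ (L ζ) * X ^ q = C (L ζ) * X ^ m := by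
    intro ζ hs
    simp only [L, map_add, map_sub, map_mul, map_pow, hs, hφA]
    linear_combination wN - C ζ * wK + C ζ ^ 2 * C A₃ * wM
  have hprod : Z ∣ L 1 * L η * L (η ^ 2) := by
    obtain ⟨a, ha⟩ := hL 1 (by ring)
    obtain ⟨b, hb⟩ := hL η hη3
    obtain ⟨c, hc⟩ := hL (η ^ 2) (by linear_combination (η ^ 3 + 1) * hη3)
    obtain ⟨t, ht⟩ := h3.exists_right_inv
    refine hZU _ (hZU _ ⟨t * (a * L η * L (η ^ 2) + b * L 1 * L (η ^ 2) + c * L 1 * L η), ?_⟩)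
    have e : 3 * U ^ 2 * (L 1 * L η * L (η ^ 2)) =
        Z * (a * L η * L (η ^ 2) + b * L 1 * L (η ^ 2) + c * L 1 * L η) := by
      linear_combination L η * L (η ^ 2) * ha + L 1 * L (η ^ 2) * hb + L 1 * L η * hc
        - L 1 * L η * L (η ^ 2) * (U * V * hη + V ^ 2 * (hη + η * hη3))
    linear_combination t * e - U ^ 2 * (L 1 * L η * L (η ^ 2)) * ht
  obtain ⟨y, hy⟩ := hprod
  have hy0 : y = 0 := by
    refine eq_zero_of_coaction φ (a := 4 * q) (c := 3 * m) (by omega) ?_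
    apply mul_left_cancel₀ hCZ
    have e1 := congrArg φ hy
    have e2 := congrArg (C : R →+* R[X]) hy
    simp only [map_mul, hφZ] at e1 e2
    have w1 := wL 1 (by simp)
    have w2 := wL η hφη
    have w3 := wL (η ^ 2) (by simp [hφη])
    calc C Z * (φ y * X ^ (4 * q)) = (C Z * X ^ q * φ y) * X ^ (3 * q) := by ring
      _ = (φ (L 1) * X ^ q) * (φ (L η) * X ^ q) * (φ (L (η ^ 2)) * X ^ q) := by
        rw [← e1]; ring
      _ = (C (L 1) * C (L η) * C (L (η ^ 2))) * X ^ (3 * m) := by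
        rw [w1, w2, w3]; ring
      _ = _ := by rw [e2]; ring
  rw [hy0, mul_zero] at hy
  have s1 := sL 1 (by ring) (by simp)
  have s2 := sL η hη3 hση
  have s3 := sL (η ^ 2) (by linear_combination (η ^ 3 + 1) * hη3) (by simp [hση])
  rw [one_mul] at s1
  rw [show η * η ^ 2 = 1 by rw [← hη3]; ring] at s2
  rw [show η ^ 2 * η ^ 2 = η by linear_combination η * hη3] at s3
  have hall : L 1 = 0 ∧ L η = 0 ∧ L (η ^ 2) = 0 := by
    rcases mul_eq_zero.1 hy with h | h
    · rcases mul_eq_zero.1 h with h | h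
      · rw [h, map_zero, mul_zero] at s1
        rw [← s1, map_zero, mul_zero] at s3
        exact ⟨h, s3.symm, s1.symm⟩
      · rw [h, map_zero, mul_zero] at s2
        rw [← s2, map_zero, mul_zero] at s1
        exact ⟨s2.symm, h, s1.symm⟩
    · rw [h, map_zero, mul_zero] at s3
      rw [← s3, map_zero, mul_zero] at s2
      exact ⟨s2.symm, s3.symm, h⟩
  obtain ⟨l1, l2, l3⟩ := hall
  simp only [L] at l1 l2 l3
  have N0 : N = 0 := by
    apply mul_left_cancel₀ h3'
    linear_combination l1 + l2 + l3 + (K - A₃ * M) * hη - A₃ * M * η * hη3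
  have K0 : K = 0 := by
    apply mul_left_cancel₀ h3'
    linear_combination - (l1 + η ^ 2 * l2 + η * l3) + N * hη + A₃ * M * (hη + η * hη3) -
      2 * K * hη3 + A₃ * M * η ^ 2 * hη3
  have M0 : M = 0 := by
    apply mul_left_cancel₀ (mul_ne_zero h3' hA₃)
    linear_combination l1 + l2 * η + l3 * η ^ 2 - N * hη + K * (hη + η * hη3) -
      A₃ * M * (hη3 + (η ^ 3 + 1) * hη3)
  subst N0 K0 M0
  have G0 : G = 0 := by
    apply mul_left_cancel₀ (mul_ne_zero hA₃ hZ)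
    linear_combination -hc
  subst G0
  refine ⟨by ring, ?_, ?_, by ring⟩
  · apply mul_right_cancel₀ hU; linear_combination h1
  · apply mul_right_cancel₀ hV; linear_combination -hG

section CoprimeDivision

/-- Relatively prime scalars of a unique factorization domain act regularly on free modules. -/
theorem algebraMap_dvd_of_dvd_mul {A R : Type*} [CommRing A] [IsDomain A]
    [DecompositionMonoid A] [CommRing R] [Algebra A R] [Module.Free A R] {a b : A}
    (hab : IsRelPrime a b) {y : R} (h : algebraMap A R a ∣ algebraMap A R b * y) :
    algebraMap A R a ∣ y := by
  obtain ⟨c, hc⟩ := h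
  let B := Module.Free.chooseBasis A R
  have h1 : ∀ i, a ∣ B.repr y i := by
    intro i
    refine hab.dvd_of_dvd_mul_left ⟨B.repr c i, ?_⟩
    have := congrArg (fun t => B.repr t i) hc
    simpa [← Algebra.smul_def] using this
  choose d hd using h1
  refine ⟨∑ i ∈ (B.repr y).support, d i • B i, ?_⟩
  rw [← Algebra.smul_def, Finset.smul_sum]
  conv_lhs => rw [← B.linearCombination_repr y, Finsupp.linearCombination_apply, Finsupp.sum]
  refine Finset.sum_congr rfl fun i _ => ?_
  rw [smul_smul, ← hd]

end CoprimeDivision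

section CubicRing

open MvPolynomial

variable {k : Type*} [Field k]

/-- The monic cubic `T³ - a₁zvT - (v³ + a₃z³)` over `k[z, v]`. -/
noncomputable def cubicPoly (a₁ a₃ : k) : Polynomial (MvPolynomial (Fin 2) k) :=
  Polynomial.X ^ 3 + Polynomial.C (-(C a₁ * X 0 * X 1)) * Polynomial.X +
    Polynomial.C (-(X 1 ^ 3 + C a₃ * X 0 ^ 3))

theorem cubicPoly_natDegree (a₁ a₃ : k) : (cubicPoly a₁ a₃).natDegree = 3 := by
  unfold cubicPoly; compute_degree!

theorem cubicPoly_monic (a₁ a₃ : k) : (cubicPoly a₁ a₃).Monic := by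
  unfold cubicPoly; monicity!

/-- The homogeneous coordinate ring of the plane cubic `u³ = v³ + a₁uvz + a₃z³`. -/
abbrev CubicRing (a₁ a₃ : k) : Type _ := AdjoinRoot (cubicPoly a₁ a₃)

namespace CubicRing

variable (a₁ a₃ : k)

/-- The coordinate `z`. -/
noncomputable def z : CubicRing a₁ a₃ := algebraMap (MvPolynomial (Fin 2) k) _ (X 0)
/-- The coordinate `v`. -/
noncomputable def v : CubicRing a₁ a₃ := algebraMap (MvPolynomial (Fin 2) k) _ (X 1)
/-- The coordinate `u`. -/
noncomputable def u : CubicRing a₁ a₃ := AdjoinRoot.root _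

theorem u_pow_three : u a₁ a₃ ^ 3 = v a₁ a₃ ^ 3 +
    algebraMap k _ a₁ * u a₁ a₃ * v a₁ a₃ * z a₁ a₃ + algebraMap k _ a₃ * z a₁ a₃ ^ 3 := by
  have h : Polynomial.eval₂ (AdjoinRoot.of (cubicPoly a₁ a₃)) (AdjoinRoot.root _)
    (Polynomial.X ^ 3 + Polynomial.C (-(C a₁ * X 0 * X 1)) * Polynomial.X +
    Polynomial.C (-(X 1 ^ 3 + C a₃ * X 0 ^ 3))) = 0 := AdjoinRoot.eval₂_root (cubicPoly a₁ a₃)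
  simp only [Polynomial.eval₂_add, Polynomial.eval₂_mul, Polynomial.eval₂_pow,
    Polynomial.eval₂_X, Polynomial.eval₂_C] at h
  simp only [map_neg, map_mul, map_add, map_pow] at h
  have hc : ∀ c : k, algebraMap k (CubicRing a₁ a₃) c = AdjoinRoot.of _ (C c) := fun c => rfl
  simp only [u, v, z, hc, AdjoinRoot.algebraMap_eq]
  linear_combination h

instance : Module.Free (MvPolynomial (Fin 2) k) (CubicRing a₁ a₃) :=
  Module.Free.of_basis (AdjoinRoot.powerBasis' (cubicPoly_monic a₁ a₃)).basis

theorem isDomain (h : a₁ ^ 3 ≠ 27 * a₃) : IsDomain (CubicRing a₁ a₃) := by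
  have hirr : Irreducible (cubicPoly a₁ a₃) := by
    rw [(cubicPoly_monic a₁ a₃).irreducible_iff_roots_eq_zero_of_degree_le_three
      (by rw [cubicPoly_natDegree]; norm_num) (by rw [cubicPoly_natDegree])]
    refine Multiset.eq_zero_of_forall_notMem fun r hr => ?_
    have hr' := Polynomial.isRoot_of_mem_roots hr
    simp only [cubicPoly, Polynomial.IsRoot, Polynomial.eval_add, Polynomial.eval_mul,
      Polynomial.eval_pow, Polynomial.eval_X, Polynomial.eval_C] at hr'
    have h1 := congrArg (aeval ![Polynomial.X, (1 : Polynomial k)]) hr'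
    simp only [map_add, map_mul, map_neg, map_pow, aeval_X, map_zero, Matrix.cons_val_zero,
      Matrix.cons_val_one, algHom_C, Polynomial.algebraMap_eq] at h1
    set s := aeval ![Polynomial.X, (1 : Polynomial k)] r
    have h2 : s ^ 3 = Polynomial.C a₁ * Polynomial.X * s + 1 +
      Polynomial.C a₃ * Polynomial.X ^ 3 := by linear_combination h1
    have hdeg : s.natDegree ≤ 1 := by
      by_contra! hlt
      have h3 : (s ^ 3).natDegree ≤ max (1 + s.natDegree) 3 := by
        rw [h2]
        refine (Polynomial.natDegree_add_le _ _).trans (max_le_max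
          ((Polynomial.natDegree_add_le _ _).trans (max_le ?_ ?_)) ?_)
        · refine Polynomial.natDegree_mul_le.trans (Nat.add_le_add_right ?_ _)
          compute_degree
        · simp
        · compute_degree
      rw [Polynomial.natDegree_pow] at h3
      omega
    obtain ⟨b, c, hbc⟩ := Polynomial.exists_eq_X_add_C_of_natDegree_le_one hdeg
    rw [hbc] at h2
    have h4 : Polynomial.C (b ^ 3 - a₃) * Polynomial.X ^ 3 +
        Polynomial.C (3 * b ^ 2 * c - a₁ * b) * Polynomial.X ^ 2 +
        Polynomial.C (3 * b * c ^ 2 - a₁ * c) * Polynomial.X + Polynomial.C (c ^ 3 - 1) = 0 := by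
      simp only [map_sub, map_mul, map_pow, map_one, map_ofNat]
      linear_combination h2
    have e3 := congrArg (fun P => Polynomial.coeff P 3) h4
    have e1 := congrArg (fun P => Polynomial.coeff P 1) h4
    have e0 := congrArg (fun P => Polynomial.coeff P 0) h4
    simp [-map_sub, -map_mul, -map_pow, -map_add, Polynomial.coeff_X, Polynomial.coeff_C, Polynomial.coeff_X_pow] at e3 e1 e0
    have hc0 : c ≠ 0 := by rintro rfl; simp at e0
    have e1' : 3 * b * c = a₁ := by
      apply mul_left_cancel₀ hc0; linear_combination e1
    apply h
    rw [← e1']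
    linear_combination 27 * c ^ 3 * e3 + 27 * a₃ * e0
  exact AdjoinRoot.isDomain_of_prime hirr.prime

variable {a₁ a₃}

/-- Algebra maps out of the cubic ring. -/
noncomputable def lift {S : Type*} [CommRing S] [Algebra k S] (z' v' u' : S)
    (h : u' ^ 3 = v' ^ 3 + algebraMap k S a₁ * u' * v' * z' + algebraMap k S a₃ * z' ^ 3) :
    CubicRing a₁ a₃ →ₐ[k] S :=
  AdjoinRoot.liftAlgHom _ (aeval ![z', v']) u' (by
    simp only [cubicPoly, Polynomial.eval₂_add, Polynomial.eval₂_mul, Polynomial.eval₂_pow,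
      Polynomial.eval₂_X, Polynomial.eval₂_C]
    simp
    linear_combination h)

section

variable {S : Type*} [CommRing S] [Algebra k S] {z' v' u' : S}
    (h : u' ^ 3 = v' ^ 3 + algebraMap k S a₁ * u' * v' * z' + algebraMap k S a₃ * z' ^ 3)

@[simp] theorem lift_z : lift z' v' u' h (z a₁ a₃) = z' := by
  simp [lift, z, AdjoinRoot.algebraMap_eq]

@[simp] theorem lift_v : lift z' v' u' h (v a₁ a₃) = v' := by
  simp [lift, v, AdjoinRoot.algebraMap_eq]

@[simp] theorem lift_u : lift z' v' u' h (u a₁ a₃) = u' := by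
  simp [lift, u]

end

theorem isRelPrime_z : IsRelPrime (X 0 : MvPolynomial (Fin 2) k) (X 1 ^ 3 + C a₃ * X 0 ^ 3) := by
  rw [X_prime.irreducible.isRelPrime_iff_not_dvd]
  rintro ⟨c, hc⟩
  have := congrArg (eval ![0, 1]) hc
  simp at this

theorem isRelPrime_v (h : a₃ ≠ 0) :
    IsRelPrime (X 1 : MvPolynomial (Fin 2) k) (X 1 ^ 3 + C a₃ * X 0 ^ 3) := by
  rw [X_prime.irreducible.isRelPrime_iff_not_dvd]
  rintro ⟨c, hc⟩
  have := congrArg (eval ![1, 0]) hc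
  simp [h] at this

theorem u_mul : algebraMap (MvPolynomial (Fin 2) k) (CubicRing a₁ a₃) (X 1 ^ 3 + C a₃ * X 0 ^ 3) =
    (u a₁ a₃ ^ 2 - algebraMap k _ a₁ * v a₁ a₃ * z a₁ a₃) * u a₁ a₃ := by
  have hc : algebraMap k (CubicRing a₁ a₃) a₃ = algebraMap (MvPolynomial (Fin 2) k) _ (C a₃) := rfl
  have h := u_pow_three a₁ a₃
  rw [hc] at h
  simp only [map_add, map_mul, map_pow]
  change v a₁ a₃ ^ 3 + _ * z a₁ a₃ ^ 3 = _
  linear_combination -h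

theorem z_dvd_of_dvd_u_mul (q : ℕ) {y : CubicRing a₁ a₃}
    (h : z a₁ a₃ ^ q ∣ u a₁ a₃ ^ q * y) : z a₁ a₃ ^ q ∣ y := by
  rw [z, ← map_pow] at h ⊢
  refine algebraMap_dvd_of_dvd_mul ((isRelPrime_z (a₃ := a₃)).pow (m := q) (n := q)) ?_
  rw [map_pow _ (X 1 ^ 3 + C a₃ * X 0 ^ 3), u_mul, mul_pow, mul_assoc]
  exact h.mul_left _

theorem v_dvd_of_dvd_u_mul (h₃ : a₃ ≠ 0) (q : ℕ) {y : CubicRing a₁ a₃}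
    (h : v a₁ a₃ ^ q ∣ u a₁ a₃ ^ q * y) : v a₁ a₃ ^ q ∣ y := by
  rw [v, ← map_pow] at h ⊢
  refine algebraMap_dvd_of_dvd_mul ((isRelPrime_v h₃).pow (m := q) (n := q)) ?_
  rw [map_pow _ (X 1 ^ 3 + C a₃ * X 0 ^ 3), u_mul, mul_pow, mul_assoc]
  exact h.mul_left _

theorem isRelPrime_X {i j : Fin 2} (hij : i ≠ j) :
    IsRelPrime (X i : MvPolynomial (Fin 2) k) (X j) := by
  rw [X_prime.irreducible.isRelPrime_iff_not_dvd, X_dvd_X]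
  exact hij

theorem z_dvd_of_dvd_v_mul (q : ℕ) {y : CubicRing a₁ a₃}
    (h : z a₁ a₃ ^ q ∣ v a₁ a₃ ^ q * y) : z a₁ a₃ ^ q ∣ y := by
  rw [z, v, ← map_pow, ← map_pow] at h
  rw [z, ← map_pow]
  exact algebraMap_dvd_of_dvd_mul (isRelPrime_X (by decide)).pow h

theorem v_dvd_of_dvd_z_mul (q : ℕ) {y : CubicRing a₁ a₃}
    (h : v a₁ a₃ ^ q ∣ z a₁ a₃ ^ q * y) : v a₁ a₃ ^ q ∣ y := by
  rw [z, v, ← map_pow, ← map_pow] at h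
  rw [v, ← map_pow]
  exact algebraMap_dvd_of_dvd_mul (isRelPrime_X (by decide)).pow h

theorem algebraMap_injective :
    Function.Injective (algebraMap (MvPolynomial (Fin 2) k) (CubicRing a₁ a₃)) :=
  AdjoinRoot.of.injective_of_degree_ne_zero (by
    rw [Polynomial.degree_eq_natDegree (cubicPoly_monic a₁ a₃).ne_zero, cubicPoly_natDegree]
    norm_num)

theorem z_ne_zero : z a₁ a₃ ≠ 0 := by
  rw [z, Ne, map_eq_zero_iff _ algebraMap_injective]; exact X_ne_zero _

theorem v_ne_zero : v a₁ a₃ ≠ 0 := by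
  rw [v, Ne, map_eq_zero_iff _ algebraMap_injective]; exact X_ne_zero _

theorem u_ne_zero : u a₁ a₃ ≠ 0 := by
  intro h
  have := u_mul (a₁ := a₁) (a₃ := a₃)
  rw [h, mul_zero, map_eq_zero_iff _ algebraMap_injective] at this
  have := congrArg (eval ![0, 1]) this
  simp at this

end CubicRing

end CubicRing

section StandardForms

open MvPolynomial

variable {k : Type*} [Field k]

/-- Binary forms inside `k[X₀, X₁, X₂, X₃]`. -/
noncomputable abbrev binary : MvPolynomial (Fin 2) k →ₐ[k] MvPolynomial (Fin 4) k :=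
  rename ![0, 1]

/-- The normal form `A + B X₂ + C X₃ + D X₂ X₃` with coefficients in `k[X₀, X₁]`. -/
noncomputable def stdForm (A B C D : MvPolynomial (Fin 2) k) : MvPolynomial (Fin 4) k :=
  binary A + binary B * X 2 + binary C * X 3 + binary D * (X 2 * X 3)

/-- The ideal contains monic quadratic relations for `X₂` and `X₃` over `k[X₀, X₁]`. -/
structure HasQuadraticRelations (Q : Ideal (MvPolynomial (Fin 4) k)) : Prop where
  rel₂ : ∃ F : MvPolynomial (Fin 2) k, F.IsHomogeneous 2 ∧ X 2 ^ 2 - binary F ∈ Q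
  rel₃ : ∃ (G L L' : MvPolynomial (Fin 2) k) (c : k), G.IsHomogeneous 2 ∧ L.IsHomogeneous 1 ∧
    L'.IsHomogeneous 1 ∧
    X 3 ^ 2 - (binary G + binary L * X 2 + (binary L' + C c * X 2) * X 3) ∈ Q

/-- Congruence to a standard form of degree `m`. -/
def IsStd (Q : Ideal (MvPolynomial (Fin 4) k)) (m : ℕ) (x : MvPolynomial (Fin 4) k) : Prop :=
  ∃ A B C D : MvPolynomial (Fin 2) k, A.IsHomogeneous m ∧ (B * X 0).IsHomogeneous m ∧
    (C * X 0).IsHomogeneous m ∧ (D * X 0 ^ 2).IsHomogeneous m ∧ x - stdForm A B C D ∈ Q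

variable {Q : Ideal (MvPolynomial (Fin 4) k)} {m : ℕ} {x y : MvPolynomial (Fin 4) k}

theorem IsStd.add (hx : IsStd Q m x) (hy : IsStd Q m y) : IsStd Q m (x + y) := by
  obtain ⟨A, B, C, D, hA, hB, hC, hD, h⟩ := hx
  obtain ⟨A', B', C', D', hA', hB', hC', hD', h'⟩ := hy
  refine ⟨A + A', B + B', C + C', D + D', hA.add hA', ?_, ?_, ?_, ?_⟩
  · rw [add_mul]; exact hB.add hB'
  · rw [add_mul]; exact hC.add hC'
  · rw [add_mul]; exact hD.add hD'
  · convert Q.add_mem h h' using 1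
    simp only [stdForm, map_add]; ring

theorem IsStd.zero : IsStd Q m 0 :=
  ⟨0, 0, 0, 0, by simp [isHomogeneous_zero, stdForm]⟩

theorem IsStd.C (c : k) : IsStd Q 0 (C c) :=
  ⟨MvPolynomial.C c, 0, 0, 0, by simp [isHomogeneous_zero, isHomogeneous_C, stdForm]⟩

theorem IsStd.binary_mul (i : Fin 2) (hx : IsStd Q m x) : IsStd Q (m + 1) (x * binary (X i)) := by
  obtain ⟨A, B, C, D, hA, hB, hC, hD, h⟩ := hx
  have hi : (X i : MvPolynomial (Fin 2) k).IsHomogeneous 1 := isHomogeneous_X _ _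
  refine ⟨A * X i, B * X i, C * X i, D * X i, hA.mul hi, ?_, ?_, ?_, ?_⟩
  · convert hB.mul hi using 1; ring
  · convert hC.mul hi using 1; ring
  · convert hD.mul hi using 1; ring
  · convert Q.mul_mem_right (binary (X i)) h using 1
    simp only [stdForm, map_mul]; ring

theorem isHomogeneous_of_mul_X {σ : Type*} {i : σ} {B : MvPolynomial σ k} {n : ℕ}
    (h : (B * X i).IsHomogeneous (n + 1)) : B.IsHomogeneous n := by
  intro d hd
  have := @h (d + Finsupp.single i 1) (by rwa [coeff_mul_X])
  rw [map_add] at this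
  have h1 : Finsupp.weight (1 : σ → ℕ) (Finsupp.single i 1) = 1 := by simp [Finsupp.weight_apply]
  omega

theorem IsStd.mul_X_two (hQ : HasQuadraticRelations Q) (hx : IsStd Q m x) :
    IsStd Q (m + 1) (x * X 2) := by
  obtain ⟨A, B, C, D, hA, hB, hC, hD, h⟩ := hx
  obtain ⟨F, hF, hFQ⟩ := hQ.rel₂
  have hX := isHomogeneous_X k (0 : Fin 2)
  refine ⟨B * F, A, D * F, C, ?_, hA.mul hX, ?_, ?_, ?_⟩
  · refine isHomogeneous_of_mul_X (i := 0) ?_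
    convert hB.mul hF using 1; ring
  · refine isHomogeneous_of_mul_X (i := 0) ?_
    convert hD.mul hF using 1; ring
  · convert hC.mul hX using 1; ring
  · convert Q.add_mem (Q.mul_mem_right (X 2) h)
      (Q.mul_mem_left (binary B + binary D * X 3) hFQ) using 1
    simp only [stdForm, map_mul]; ring

theorem IsStd.mul_X_three (hQ : HasQuadraticRelations Q) (hx : IsStd Q m x) :
    IsStd Q (m + 1) (x * X 3) := by
  obtain ⟨A, B, C, D, hA, hB, hC, hD, h⟩ := hx
  obtain ⟨F, hF, hFQ⟩ := hQ.rel₂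
  obtain ⟨G, L, L', c, hG, hL, hL', hGQ⟩ := hQ.rel₃
  have hX := isHomogeneous_X k (0 : Fin 2)
  refine ⟨C * G + D * F * L, C * L + D * G, A + C * L' + MvPolynomial.C c * (D * F),
    B + MvPolynomial.C c * C + D * L', ?_, ?_, ?_, ?_, ?_⟩
  · refine isHomogeneous_of_mul_X (i := 0) ?_
    rw [add_mul]
    refine IsHomogeneous.add ?_ ?_
    · convert hC.mul hG using 1; ring
    · refine isHomogeneous_of_mul_X (i := 0) ?_
      convert hD.mul (hF.mul hL) using 1; ring
  · rw [add_mul]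
    refine IsHomogeneous.add ?_ ?_
    · convert hC.mul hL using 1; ring
    · refine isHomogeneous_of_mul_X (i := 0) ?_
      convert hD.mul hG using 1; ring
  · rw [add_mul, add_mul]
    refine IsHomogeneous.add (IsHomogeneous.add (hA.mul hX) ?_) ?_
    · convert hC.mul hL' using 1; ring
    · refine isHomogeneous_of_mul_X (i := 0) ?_
      convert (hD.mul hF).C_mul c using 1; ring
  · rw [add_mul, add_mul]
    refine IsHomogeneous.add (IsHomogeneous.add ?_ ?_) ?_
    · convert hB.mul hX using 1; ring
    · convert (hC.mul hX).C_mul c using 1; ring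
    · convert hD.mul hL' using 1; ring
  · convert Q.add_mem (Q.add_mem (Q.mul_mem_right (X 3) h)
      (Q.mul_mem_left (binary C + binary D * X 2) hGQ))
      (Q.mul_mem_left (binary D * (binary L + MvPolynomial.C c * X 3)) hFQ) using 1
    simp only [stdForm, map_mul, map_add, rename_C]; ring

theorem IsStd.mul_X (hQ : HasQuadraticRelations Q) (hx : IsStd Q m x) (i : Fin 4) :
    IsStd Q (m + 1) (x * X i) := by
  fin_cases i
  · simpa using hx.binary_mul 0
  · simpa using hx.binary_mul 1
  · exact hx.mul_X_two hQ
  · exact hx.mul_X_three hQ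

theorem isStd_monomial (hQ : HasQuadraticRelations Q) (d : Fin 4 →₀ ℕ) (c : k) :
    IsStd Q d.degree (monomial d c) := by
  have hpow : ∀ {m x} (_ : IsStd Q m x) (i : Fin 4) (n : ℕ), IsStd Q (m + n) (x * X i ^ n) := by
    intro m x hx i n
    induction n with
    | zero => simpa using hx
    | succ n ih => rw [pow_succ, ← mul_assoc, ← add_assoc]; exact ih.mul_X hQ i
  have h := hpow (hpow (hpow (hpow (IsStd.C (Q := Q) c) 0 (d 0)) 1 (d 1)) 2 (d 2)) 3 (d 3)
  rw [monomial_eq, Finsupp.prod_fintype _ _ (by simp), Fin.prod_univ_four,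
    Finsupp.degree_eq_sum, Fin.sum_univ_four]
  convert h using 1
  · ring
  · ring

theorem isStd_of_isHomogeneous (hQ : HasQuadraticRelations Q) (hx : x.IsHomogeneous m) :
    IsStd Q m x := by
  classical
  rw [x.as_sum]
  refine Finset.sum_induction _ (IsStd Q m) (fun _ _ => IsStd.add) IsStd.zero fun d hd => ?_
  have : d.degree = m := by
    by_contra hne
    exact (mem_support_iff.1 hd) (hx.coeff_eq_zero hne)
  exact this ▸ isStd_monomial hQ d _

/-- A binary form of degree `n + 1 ≥ q` is a multiple of `X₀` modulo `X₁ ^ q`. -/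
theorem exists_eq_X_mul_add {A : MvPolynomial (Fin 2) k} {n q : ℕ} (hq : q ≤ n + 1)
    (hA : A.IsHomogeneous (n + 1)) :
    ∃ A' E : MvPolynomial (Fin 2) k, A'.IsHomogeneous n ∧ A = A' * X 0 + E * X 1 ^ q := by
  classical
  let P : MvPolynomial (Fin 2) k → Prop := fun A =>
    ∃ A' E : MvPolynomial (Fin 2) k, A'.IsHomogeneous n ∧ A = A' * X 0 + E * X 1 ^ q
  change P A
  rw [A.as_sum]
  refine Finset.sum_induction _ P ?_ ⟨0, 0, isHomogeneous_zero _ _ _, by simp⟩ fun d hd => ?_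
  · rintro _ _ ⟨A, E, hA, rfl⟩ ⟨B, E', hB, rfl⟩
    exact ⟨A + B, E + E', hA.add hB, by ring⟩
  have hdeg : d.degree = n + 1 := by
    by_contra hne
    exact (mem_support_iff.1 hd) (hA.coeff_eq_zero hne)
  have hdeg' : d 0 + d 1 = n + 1 := by
    rw [← hdeg, Finsupp.degree_eq_sum, Fin.sum_univ_two]
  have hmon : ∀ c : k, monomial d c = C c * X 0 ^ d 0 * X 1 ^ d 1 := by
    intro c
    rw [monomial_eq, Finsupp.prod_fintype _ _ (by simp), Fin.prod_univ_two, mul_assoc]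
  rw [hmon]
  rcases Nat.eq_zero_or_pos (d 0) with h0 | h0
  · refine ⟨0, C (coeff d A) * X 1 ^ (d 1 - q), isHomogeneous_zero _ _ _, ?_⟩
    rw [mul_assoc (C _) (X 1 ^ _), ← pow_add, Nat.sub_add_cancel (by omega), h0]; ring
  · refine ⟨C (coeff d A) * (X 0 ^ (d 0 - 1) * X 1 ^ d 1), 0, IsHomogeneous.C_mul ?_ _, ?_⟩
    · convert (isHomogeneous_X_pow (0 : Fin 2) (d 0 - 1)).mul
        (isHomogeneous_X_pow (1 : Fin 2) (d 1)) using 1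
      omega
    · obtain ⟨e, he⟩ := Nat.exists_eq_add_of_le' h0
      rw [he]; simp; ring

theorem exists_mul_X_zero_add (hQ : HasQuadraticRelations Q) {q : ℕ} (hq : 0 < q) (hm : q + 1 ≤ m)
    (hx : x.IsHomogeneous (m + 1)) :
    ∃ y, y.IsHomogeneous m ∧ x - y * X 0 ∈ Q ⊔ Ideal.span {X 1 ^ q} := by
  obtain ⟨A, B, C, D, hA, hB, hC, hD, h⟩ := isStd_of_isHomogeneous hQ hx
  obtain ⟨m, rfl⟩ := Nat.exists_eq_add_of_le' (show 1 ≤ m by omega)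
  obtain ⟨A', EA, hA', rfl⟩ := exists_eq_X_mul_add (q := q) (by omega) hA
  obtain ⟨B', EB, hB', rfl⟩ := exists_eq_X_mul_add (q := q) (by omega) (isHomogeneous_of_mul_X hB)
  obtain ⟨C', EC, hC', rfl⟩ := exists_eq_X_mul_add (q := q) (by omega) (isHomogeneous_of_mul_X hC)
  obtain ⟨m, rfl⟩ := Nat.exists_eq_add_of_le' (show 1 ≤ m by omega)
  rw [pow_two, ← mul_assoc] at hD
  obtain ⟨D', ED, hD', rfl⟩ := exists_eq_X_mul_add (q := q) (by omega)
    (isHomogeneous_of_mul_X (isHomogeneous_of_mul_X hD))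
  refine ⟨stdForm A' B' C' D', ?_, ?_⟩
  · unfold stdForm
    refine ((hA'.rename_isHomogeneous.add ?_).add ?_).add ?_
    · exact hB'.rename_isHomogeneous.mul (isHomogeneous_X _ _)
    · exact hC'.rename_isHomogeneous.mul (isHomogeneous_X _ _)
    · exact hD'.rename_isHomogeneous.mul ((isHomogeneous_X k _).mul (isHomogeneous_X k _))
  · have hX : X 1 ^ q ∈ Q ⊔ Ideal.span {(X 1 : MvPolynomial (Fin 4) k) ^ q} :=
      Ideal.mem_sup_right (Ideal.mem_span_singleton_self _)
    convert add_mem (Ideal.mem_sup_left h) (Ideal.mul_mem_left _ (stdForm EA EB EC ED) hX) using 1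
    simp [stdForm]; ring

end StandardForms

section HilbertFunction

open MvPolynomial

variable {k : Type*} [Field k]

instance {σ : Type*} [Finite σ] (m : ℕ) : Module.Finite k (homogeneousSubmodule σ k m) :=
  Module.Finite.iff_fg.2 (homogeneousSubmodule_fg σ k m)

theorem finrank_homogeneousSubmodule_two (m : ℕ) :
    Module.finrank k (homogeneousSubmodule (Fin 2) k m) = m + 1 := by
  rw [homogeneousSubmodule_eq_finsupp_supported]
  have e := (AddMonoidAlgebra.supportedEquivFinsupp (S := k) (R := k)
    {d : Fin 2 →₀ ℕ | d.degree = m}).finrank_eq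
  have e2 : {d : Fin 2 →₀ ℕ | d.degree = m} ≃ Fin (m + 1) :=
    { toFun := fun d => ⟨d.1 0, by
        have := d.2
        simp only [Set.mem_ofPred_eq, Finsupp.degree_eq_sum, Fin.sum_univ_two] at this
        omega⟩
      invFun := fun i => ⟨Finsupp.equivFunOnFinite.symm ![i.1, m - i.1], by
        simp [Finsupp.degree_eq_sum, Fin.sum_univ_two]; omega⟩
      left_inv := by
        rintro ⟨d, hd⟩
        simp only [Set.mem_ofPred_eq, Finsupp.degree_eq_sum, Fin.sum_univ_two] at hd
        ext i
        fin_cases i <;> simp; omega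
      right_inv := fun i => by simp }
  have : Fintype {d : Fin 2 →₀ ℕ | d.degree = m} := Fintype.ofEquiv _ e2.symm
  refine e.trans ?_
  rw [Module.finrank_finsupp_self, Fintype.card_congr e2, Fintype.card_fin]

/-- The degree `m` part of a submodule of a polynomial ring. -/
noncomputable abbrev gradedPart {σ : Type*} (J : Ideal (MvPolynomial σ k)) (m : ℕ) :
    Submodule k (homogeneousSubmodule σ k m) :=
  (J.restrictScalars k).comap (homogeneousSubmodule σ k m).subtype

/-- The Hilbert function of a homogeneous quotient. -/
noncomputable def hilb {σ : Type*} (J : Ideal (MvPolynomial σ k)) (m : ℕ) : ℕ :=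
  Module.finrank k (homogeneousSubmodule σ k m ⧸ gradedPart J m)

/-- Distinct standard forms are incongruent. -/
def StdIndependent (Q : Ideal (MvPolynomial (Fin 4) k)) : Prop :=
  ∀ A B C D : MvPolynomial (Fin 2) k, stdForm A B C D ∈ Q → A = 0 ∧ B = 0 ∧ C = 0 ∧ D = 0

theorem stdForm_isHomogeneous {m : ℕ} {A B C D : MvPolynomial (Fin 2) k}
    (hA : A.IsHomogeneous (m + 2)) (hB : B.IsHomogeneous (m + 1)) (hC : C.IsHomogeneous (m + 1))
    (hD : D.IsHomogeneous m) : (stdForm A B C D).IsHomogeneous (m + 2) := by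
  refine ((hA.rename_isHomogeneous.add ?_).add ?_).add ?_
  · exact hB.rename_isHomogeneous.mul (isHomogeneous_X _ _)
  · exact hC.rename_isHomogeneous.mul (isHomogeneous_X _ _)
  · exact hD.rename_isHomogeneous.mul ((isHomogeneous_X k _).mul (isHomogeneous_X k _))

theorem hilb_eq_four_mul {Q : Ideal (MvPolynomial (Fin 4) k)} (hQ : HasQuadraticRelations Q)
    (hi : StdIndependent Q) (m : ℕ) : hilb Q (m + 2) = 4 * (m + 2) := by
  let H := fun n => homogeneousSubmodule (Fin 2) k n
  let φ : (H (m + 2) × H (m + 1) × H (m + 1) × H m) →ₗ[k]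
      homogeneousSubmodule (Fin 4) k (m + 2) :=
    { toFun := fun x => ⟨stdForm x.1.1 x.2.1.1 x.2.2.1.1 x.2.2.2.1,
        stdForm_isHomogeneous x.1.2 x.2.1.2 x.2.2.1.2 x.2.2.2.2⟩
      map_add' := fun x y => by ext1; simp [stdForm]; ring
      map_smul' := fun c x => by ext1; simp [stdForm, smul_add] }
  let ψ := (gradedPart Q (m + 2)).mkQ ∘ₗ φ
  have hinj : Function.Injective ψ := by
    rw [injective_iff_map_eq_zero]
    rintro ⟨A, B, C, D⟩ h
    rw [LinearMap.comp_apply, Submodule.mkQ_apply, Submodule.Quotient.mk_eq_zero] at h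
    obtain ⟨h1, h2, h3, h4⟩ := hi A B C D h
    ext1
    · exact Subtype.ext h1
    ext1
    · exact Subtype.ext h2
    ext1
    · exact Subtype.ext h3
    · exact Subtype.ext h4
  have hsurj : Function.Surjective ψ := by
    intro y
    obtain ⟨⟨x, hx⟩, rfl⟩ := Submodule.mkQ_surjective _ y
    obtain ⟨A, B, C, D, hA, hB, hC, hD, h⟩ := isStd_of_isHomogeneous hQ hx
    rw [pow_two, ← mul_assoc] at hD
    refine ⟨⟨⟨A, hA⟩, ⟨B, isHomogeneous_of_mul_X hB⟩, ⟨C, isHomogeneous_of_mul_X hC⟩,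
      ⟨D, isHomogeneous_of_mul_X (isHomogeneous_of_mul_X hD)⟩⟩, ?_⟩
    symm
    exact (Submodule.Quotient.eq _).2 h
  rw [hilb, ← (LinearEquiv.ofBijective ψ ⟨hinj, hsurj⟩).finrank_eq]
  simp only [Module.finrank_prod, H, finrank_homogeneousSubmodule_two]
  ring

end HilbertFunction

section Counting

open MvPolynomial

variable {k : Type*} [Field k]

theorem homogeneousComponent_mul_of_isHomogeneous {σ : Type*} {c h : MvPolynomial σ k} {n : ℕ}
    (hh : h.IsHomogeneous n) (m : ℕ) : homogeneousComponent m (c * h) =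
      if n ≤ m then homogeneousComponent (m - n) c * h else 0 := by
  let _ : GradedAlgebra (homogeneousSubmodule σ k) := gradedAlgebra
  simp only [← decomposition.decompose'_apply]
  exact DirectSum.coe_decompose_mul_of_right_mem (homogeneousSubmodule σ k) m hh

variable (k) in
/-- The ideal of `q`-th powers of the variables. -/
noncomputable abbrev powIdeal (q : ℕ) : Ideal (MvPolynomial (Fin 4) k) :=
  Ideal.span (Set.range fun i : Fin 4 => X i ^ q)

theorem mem_sup_powIdeal {Q : Ideal (MvPolynomial (Fin 4) k)} {q : ℕ}
    {x : MvPolynomial (Fin 4) k} : x ∈ Q ⊔ powIdeal k q ↔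
      ∃ c : Fin 4 → MvPolynomial (Fin 4) k, x - ∑ i, c i * X i ^ q ∈ Q := by
  constructor
  · intro h
    obtain ⟨y, hy, w, hw, rfl⟩ := Submodule.mem_sup.1 h
    obtain ⟨c, rfl⟩ := Ideal.mem_span_range_iff_exists_fun.1 hw
    exact ⟨c, by simpa using hy⟩
  · rintro ⟨c, hc⟩
    have := Ideal.add_mem _ (Ideal.mem_sup_left (T := powIdeal k q) hc)
      (Ideal.mem_sup_right (S := Q) (Ideal.mem_span_range_iff_exists_fun.2 ⟨c, rfl⟩))
    simpa using this

/-- An ideal stable under taking homogeneous components. -/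
def IsGraded {σ : Type*} (J : Ideal (MvPolynomial σ k)) : Prop :=
  ∀ m, ∀ x ∈ J, homogeneousComponent m x ∈ J

theorem exists_component_sub_mem {Q : Ideal (MvPolynomial (Fin 4) k)} (hQ : IsGraded Q) {q : ℕ}
    {x : MvPolynomial (Fin 4) k} (h : x ∈ Q ⊔ powIdeal k q) (m : ℕ) :
    (m < q → homogeneousComponent m x ∈ Q) ∧ (q ≤ m → ∃ c : Fin 4 → MvPolynomial (Fin 4) k,
      (∀ i, (c i).IsHomogeneous (m - q)) ∧ homogeneousComponent m x - ∑ i, c i * X i ^ q ∈ Q) := by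
  obtain ⟨c, hc⟩ := mem_sup_powIdeal.1 h
  have h1 := hQ m _ hc
  simp only [map_sub, map_sum, homogeneousComponent_mul_of_isHomogeneous (isHomogeneous_X_pow _ q)]
    at h1
  constructor
  · intro hm
    simpa [not_le.2 hm] using h1
  · intro hm
    simp only [hm, if_true] at h1
    exact ⟨_, fun i => homogeneousComponent_isHomogeneous _ _, h1⟩

theorem IsGraded.sup_powIdeal {Q : Ideal (MvPolynomial (Fin 4) k)} (hQ : IsGraded Q) (q : ℕ) :
    IsGraded (Q ⊔ powIdeal k q) := by
  intro m x hx
  obtain ⟨h1, h2⟩ := exists_component_sub_mem hQ hx m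
  rcases lt_or_ge m q with h | h
  · exact Ideal.mem_sup_left (h1 h)
  · obtain ⟨c, -, hc⟩ := h2 h
    exact mem_sup_powIdeal.2 ⟨c, hc⟩

/-- The linear map sending a polynomial to its degree `m` component modulo `J`. -/
noncomputable def componentMk {σ : Type*} (J : Ideal (MvPolynomial σ k)) (m : ℕ) :
    MvPolynomial σ k →ₗ[k] homogeneousSubmodule σ k m ⧸ gradedPart J m :=
  (gradedPart J m).mkQ ∘ₗ
    (homogeneousComponent m).codRestrict (homogeneousSubmodule σ k m)
      fun x => homogeneousComponent_mem m x

theorem componentMk_eq_zero {σ : Type*} {J : Ideal (MvPolynomial σ k)} {m : ℕ}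
    {x : MvPolynomial σ k} : componentMk J m x = 0 ↔ homogeneousComponent m x ∈ J :=
  Submodule.Quotient.mk_eq_zero (gradedPart J m)

theorem componentMk_surjective {σ : Type*} (J : Ideal (MvPolynomial σ k)) {M : ℕ}
    (y : ∀ m : Fin M, homogeneousSubmodule σ k m ⧸ gradedPart J m) :
    ∃ x, ∀ m : Fin M, componentMk J m x = y m := by
  choose x hx using fun m : Fin M => Submodule.mkQ_surjective (gradedPart J (m : ℕ)) (y m)
  refine ⟨∑ m, (x m : MvPolynomial σ k), fun m => ?_⟩
  rw [← hx m]
  simp only [componentMk, LinearMap.comp_apply]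
  congr 1
  ext1
  change homogeneousComponent (m : ℕ) (∑ m, (x m : MvPolynomial σ k)) = x m
  rw [map_sum, Finset.sum_eq_single m]
  · rw [homogeneousComponent_of_mem (x m).2, if_pos rfl]
  · intro n _ hn
    rw [homogeneousComponent_of_mem (x n).2, if_neg]
    exact fun h => hn (Fin.ext h.symm)
  · simp

theorem finrank_quotient_of_jointly_surjective {ι V : Type*} [Fintype ι] {W : ι → Type*}
    [AddCommGroup V] [Module k V] [∀ i, AddCommGroup (W i)] [∀ i, Module k (W i)]
    [∀ i, Module.Finite k (W i)] {K : Submodule k V} (f : ∀ i, V →ₗ[k] W i)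
    (hf : ∀ y : ∀ i, W i, ∃ x, ∀ i, f i x = y i) (hK : ∀ x, x ∈ K ↔ ∀ i, f i x = 0) :
    Module.finrank k (V ⧸ K) = ∑ i, Module.finrank k (W i) := by
  have hsurj : Function.Surjective (LinearMap.pi f) := fun y => by
    obtain ⟨x, hx⟩ := hf y
    exact ⟨x, _root_.funext hx⟩
  have hK : K = LinearMap.ker (LinearMap.pi f) := by
    ext x
    rw [hK, LinearMap.mem_ker, _root_.funext_iff]
    rfl
  rw [hK, (LinearMap.quotKerEquivOfSurjective _ hsurj).finrank_eq, Module.finrank_pi_fintype]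

theorem finrank_quotient_eq_sum_hilb {σ : Type*} [Finite σ] {J : Ideal (MvPolynomial σ k)}
    (hJ : IsGraded J) {M : ℕ} (hM : ∀ m, M ≤ m → ∀ x, x.IsHomogeneous m → x ∈ J) :
    Module.finrank k (MvPolynomial σ k ⧸ J) = ∑ m ∈ Finset.range M, hilb J m := by
  have e : (MvPolynomial σ k ⧸ J) ≃ₗ[k] (MvPolynomial σ k ⧸ J.restrictScalars k) :=
    (Submodule.Quotient.restrictScalarsEquiv k J).symm
  have hmem : ∀ x, x ∈ J.restrictScalars k ↔ ∀ m : Fin M, componentMk J m x = 0 := by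
    intro x
    simp only [componentMk_eq_zero, Submodule.restrictScalars_mem]
    constructor
    · intro hx m
      exact hJ m x hx
    · intro h
      rw [← sum_homogeneousComponent x]
      refine sum_mem fun m _ => ?_
      rcases lt_or_ge m M with hm | hm
      · exact h ⟨m, hm⟩
      · exact hM m hm _ (homogeneousComponent_isHomogeneous _ _)
  rw [Finset.sum_range, e.finrank_eq]
  exact finrank_quotient_of_jointly_surjective (V := MvPolynomial σ k)
    (W := fun m : Fin M => homogeneousSubmodule σ k m ⧸ gradedPart J m)
    (K := J.restrictScalars k) (fun m : Fin M => componentMk J m)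
    (componentMk_surjective J) hmem

theorem hilb_sup_powIdeal_of_lt {Q : Ideal (MvPolynomial (Fin 4) k)} (hQ : IsGraded Q) {q m : ℕ}
    (hm : m < q) : hilb (Q ⊔ powIdeal k q) m = hilb Q m := by
  have : gradedPart (Q ⊔ powIdeal k q) m = gradedPart Q m := by
    ext x
    simp only [Submodule.mem_comap, Submodule.subtype_apply, Submodule.restrictScalars_mem]
    constructor
    · intro h
      have := (exists_component_sub_mem hQ h m).1 hm
      rwa [homogeneousComponent_of_mem x.2, if_pos rfl] at this
    · exact fun h => Ideal.mem_sup_left h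
  rw [hilb, hilb, this]

/-- Syzygies of the `q`-th powers of the variables modulo `Q` of small degree are trivial. -/
def NoSmallSyzygy (Q : Ideal (MvPolynomial (Fin 4) k)) (q : ℕ) : Prop :=
  ∀ n, 3 * n < q → ∀ b : Fin 4 → MvPolynomial (Fin 4) k, (∀ i, (b i).IsHomogeneous n) →
    ∑ i, b i * X i ^ q ∈ Q → ∀ i, b i ∈ Q

theorem finrank_pi_four (V : Type*) [AddCommGroup V] [Module k V] [Module.Finite k V] :
    Module.finrank k (Fin 4 → V) = 4 * Module.finrank k V := by
  rw [Module.finrank_pi_fintype]; simp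

theorem hilb_sup_powIdeal_add {Q : Ideal (MvPolynomial (Fin 4) k)} (hQ : IsGraded Q) {q n : ℕ}
    (hs : NoSmallSyzygy Q q) (hn : 3 * n < q) :
    hilb (Q ⊔ powIdeal k q) (q + n) + 4 * hilb Q n = hilb Q (q + n) := by
  let J := Q ⊔ powIdeal k q
  have hle : gradedPart Q (q + n) ≤ gradedPart J (q + n) := fun x hx => Ideal.mem_sup_left hx
  let H := fun n => homogeneousSubmodule (Fin 4) k n
  let φ₀ : (Fin 4 → H n) →ₗ[k] H (q + n) :=
    { toFun := fun b => ⟨∑ i, (b i : MvPolynomial (Fin 4) k) * X i ^ q, by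
        refine Submodule.sum_mem _ fun i _ => ?_
        rw [add_comm]
        exact (IsHomogeneous.mul (b i).2 (isHomogeneous_X_pow _ _))⟩
      map_add' := fun x y => by ext1; simp [add_mul, Finset.sum_add_distrib]
      map_smul' := fun c x => by ext1; simp [Finset.smul_sum] }
  let φ := (gradedPart Q (q + n)).mkQ ∘ₗ φ₀
  have hker : LinearMap.ker φ = Submodule.pi Set.univ fun _ : Fin 4 => gradedPart Q n := by
    ext b
    rw [LinearMap.mem_ker, LinearMap.comp_apply, Submodule.mkQ_apply,
      Submodule.Quotient.mk_eq_zero]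
    simp only [Submodule.mem_pi, Set.mem_univ, forall_const]
    constructor
    · exact fun h i => hs n hn (fun i => b i) (fun i => (b i).2) h i
    · intro h
      have : ∑ i, (b i : MvPolynomial (Fin 4) k) * X i ^ q ∈ Q :=
        Q.sum_mem fun i _ => Q.mul_mem_right _ (h i)
      exact this
  have hrange : LinearMap.range φ = LinearMap.ker (Submodule.factor hle) := by
    ext y
    obtain ⟨x, rfl⟩ := Submodule.mkQ_surjective _ y
    rw [LinearMap.mem_ker, Submodule.mkQ_apply]
    refine Iff.trans ?_ (Submodule.Quotient.mk_eq_zero (gradedPart J (q + n))).symm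
    constructor
    · rintro ⟨b, hb⟩
      have hb' := (Submodule.Quotient.eq _).1 hb
      refine mem_sup_powIdeal.2 ⟨fun i => b i, ?_⟩
      have := Q.neg_mem hb'
      simpa [φ₀] using this
    · intro h
      have h' : (x : MvPolynomial (Fin 4) k) ∈ J := h
      obtain ⟨c, hc, h⟩ := (exists_component_sub_mem hQ h' (q + n)).2 (by omega)
      rw [homogeneousComponent_of_mem x.2, if_pos rfl] at h
      refine ⟨fun i => ⟨c i, (by simpa using hc i : (c i).IsHomogeneous n)⟩, ?_⟩
      symm
      exact (Submodule.Quotient.eq _).2 h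
  have h1 := LinearMap.finrank_range_add_finrank_ker (Submodule.factor hle)
  rw [LinearMap.range_eq_top.2 (Submodule.factor_surjective hle), finrank_top, ← hrange,
    ← φ.quotKerEquivRange.finrank_eq,
    (Submodule.quotEquivOfEq _ _ hker).finrank_eq, (Submodule.quotientPi _).finrank_eq,
    finrank_pi_four] at h1
  simpa [hilb] using h1

theorem hilb_succ_le {Q : Ideal (MvPolynomial (Fin 4) k)} (hQ : HasQuadraticRelations Q)
    {q m : ℕ} (hq : 0 < q) (hm : q + 1 ≤ m) :
    hilb (Q ⊔ powIdeal k q) (m + 1) ≤ hilb (Q ⊔ powIdeal k q) m := by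
  let J := Q ⊔ powIdeal k q
  let μ : homogeneousSubmodule (Fin 4) k m →ₗ[k] homogeneousSubmodule (Fin 4) k (m + 1) :=
    ((LinearMap.mulRight k (X 0)).restrict fun x hx => IsHomogeneous.mul hx (isHomogeneous_X k 0))
  have hle : gradedPart J m ≤ (gradedPart J (m + 1)).comap μ :=
    fun x hx => J.mul_mem_right _ hx
  refine LinearMap.finrank_le_finrank_of_surjective (f := Submodule.mapQ _ _ μ hle) fun y => ?_
  obtain ⟨x, rfl⟩ := Submodule.mkQ_surjective _ y
  obtain ⟨y, hy, h⟩ := exists_mul_X_zero_add hQ hq hm x.2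
  refine ⟨Submodule.Quotient.mk ⟨y, hy⟩, ?_⟩
  symm
  refine (Submodule.Quotient.eq _).2 ?_
  refine (sup_le_sup_left (Ideal.span_mono ?_) Q : Q ⊔ Ideal.span {X 1 ^ q} ≤ J) h
  rintro _ rfl
  exact ⟨1, rfl⟩

end Counting

section Asymptotics

open MvPolynomial Filter

variable {k : Type*} [Field k]

theorem mem_powIdeal_of_isHomogeneous {q m : ℕ} (hm : 4 * q ≤ m) {x : MvPolynomial (Fin 4) k}
    (hx : x.IsHomogeneous m) : x ∈ powIdeal k q := by
  rcases Nat.eq_zero_or_pos q with rfl | hq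
  · have : (1 : MvPolynomial (Fin 4) k) ∈ powIdeal k 0 := Ideal.subset_span ⟨0, by simp⟩
    rw [(Ideal.eq_top_iff_one _).2 this]
    trivial
  rw [x.as_sum]
  refine Ideal.sum_mem _ fun d hd => ?_
  have hdeg : d.degree = m := by
    rw [Finsupp.degree_eq_weight_one]
    exact hx (mem_support_iff.1 hd)
  simp only [Finsupp.degree_eq_sum, Fin.sum_univ_four] at hdeg
  have : ∃ i, q ≤ d i := by
    by_contra! h
    have h0 := h 0
    have h1 := h 1
    have h2 := h 2
    have h3 := h 3
    omega
  obtain ⟨i, hi⟩ := this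
  have hmon : monomial d (coeff d x) =
      monomial (d - Finsupp.single i q) (coeff d x) * X i ^ q := by
    rw [X_pow_eq_monomial, monomial_mul, mul_one, tsub_add_cancel_of_le]
    simpa using hi
  rw [hmon]
  exact Ideal.mul_mem_left _ _ (Ideal.subset_span ⟨i, rfl⟩)

theorem sum_range_of_eq_four_mul {h : ℕ → ℕ} (h₂ : ∀ m, h (m + 2) = 4 * (m + 2)) (N : ℕ) :
    (∑ m ∈ Finset.range (N + 2), (h m : ℤ)) = h 0 + h 1 - 4 + 2 * (N + 2) * (N + 1) := by
  induction N with
  | zero => simp [Finset.sum_range_succ]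
  | succ N ih => rw [Finset.sum_range_succ, ih, h₂]; push_cast; ring

theorem abs_three_mul_sum_sub_le {j h : ℕ → ℕ} {q : ℕ} (hq : 7 ≤ q)
    (h₂ : ∀ m, h (m + 2) = 4 * (m + 2)) (hlt : ∀ m < q, j m = h m)
    (hadd : ∀ n, 3 * n < q → j (q + n) + 4 * h n = h (q + n))
    (hle : ∀ m, q + 1 ≤ m → j (m + 1) ≤ j m) :
    |3 * (∑ m ∈ Finset.range (4 * q), (j m : ℤ)) - 8 * (q : ℤ) ^ 2| ≤
      (9 * (h 0 + h 1) + 200) * (q : ℤ) := by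
  obtain ⟨N, s, hqdef, hs0, hs3⟩ : ∃ N s, q = 3 * (N + 2) + s ∧ 1 ≤ s ∧ s ≤ 3 :=
    ⟨(q - 1) / 3 - 2, q - 3 * ((q - 1) / 3), by omega, by omega, by omega⟩
  have hqz : (q : ℤ) = 3 * (N + 2) + s := by rw [hqdef]; push_cast; ring
  have hend : j (q + (N + 2)) ≤ 12 := by
    have h1 := hadd (N + 2) (by omega)
    rw [h₂, show q + (N + 2) = (q + N) + 2 by ring, h₂] at h1
    rw [show q + (N + 2) = (q + N) + 2 by ring]
    omega
  have htail : ∀ i, j (q + (N + 2) + i) ≤ 12 := by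
    intro i
    induction i with
    | zero => exact hend
    | succ i ih => exact (hle (q + (N + 2) + i) (by omega)).trans ih
  obtain ⟨M, hM⟩ := Nat.exists_eq_add_of_le (show q + (N + 2) ≤ 4 * q by omega)
  have hT : (∑ i ∈ Finset.range M, (j (q + (N + 2) + i) : ℤ)) ≤ 12 * M := by
    calc _ ≤ ∑ i ∈ Finset.range M, (12 : ℤ) := Finset.sum_le_sum fun i _ => by
          exact_mod_cast htail i
      _ = _ := by simp [mul_comm]
  have hT0 : 0 ≤ (∑ i ∈ Finset.range M, (j (q + (N + 2) + i) : ℤ)) :=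
    Finset.sum_nonneg fun i _ => by positivity
  have hmid : (∑ n ∈ Finset.range (N + 2), (j (q + n) : ℤ)) =
      ∑ n ∈ Finset.range (N + 2), (4 * (q : ℤ) + 4 * n) - 4 * ∑ n ∈ Finset.range (N + 2), (h n : ℤ) := by
    rw [Finset.mul_sum, ← Finset.sum_sub_distrib]
    refine Finset.sum_congr rfl fun n hn => ?_
    have hn' := Finset.mem_range.1 hn
    have h1 := hadd n (by omega)
    have h2 : h (q + n) = 4 * (q + n) := by
      obtain ⟨t, ht⟩ := Nat.exists_eq_add_of_le' (show 2 ≤ q + n by omega)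
      rw [ht, h₂]
    zify at h1 h2
    linarith
  have hlin : ∀ N : ℕ, ∑ n ∈ Finset.range N, (4 * (q : ℤ) + 4 * n) = 4 * q * N + 2 * N * (N - 1) := by
    intro N
    induction N with
    | zero => simp
    | succ N ih => rw [Finset.sum_range_succ, ih]; push_cast; ring
  have hfirst : (∑ m ∈ Finset.range q, (j m : ℤ)) = h 0 + h 1 - 4 + 2 * q * (q - 1) := by
    rw [Finset.sum_congr rfl fun m hm => by rw [hlt m (Finset.mem_range.1 hm)]]
    obtain ⟨t, ht⟩ := Nat.exists_eq_add_of_le' (show 2 ≤ q by omega)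
    rw [ht, sum_range_of_eq_four_mul h₂]
    push_cast; ring
  rw [hM, Finset.sum_range_add, Finset.sum_range_add, hmid, hlin, hfirst,
    sum_range_of_eq_four_mul h₂]
  set T := ∑ i ∈ Finset.range M, (j (q + (N + 2) + i) : ℤ)
  have hM' : (M : ℤ) ≤ 3 * q := by omega
  have hid : 3 * ((h 0 : ℤ) + h 1 - 4 + 2 * q * (q - 1) + (4 * q * (N + 2 : ℕ) + 2 * (N + 2 : ℕ) * ((N + 2 : ℕ) - 1) -
      4 * (h 0 + h 1 - 4 + 2 * (N + 2) * (N + 1))) + T) - 8 * q ^ 2 =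
      - 9 * (h 0 + h 1) + 36 - 6 * q + 18 * (N + 2) - 2 * s ^ 2 + 3 * T := by
    rw [hqz]; push_cast; ring
  rw [hid, abs_le]
  have hq7 : (7 : ℤ) ≤ q := by exact_mod_cast hq
  have hs2 : (s : ℤ) ^ 2 ≤ 9 := by
    have : (s : ℤ) ≤ 3 := by exact_mod_cast hs3
    nlinarith
  have hc : (0 : ℤ) ≤ (h 0 + h 1 : ℤ) * (q - 1) := mul_nonneg (by positivity) (by linarith)
  have hs0' := sq_nonneg (s : ℤ)
  constructor <;> nlinarith

/-- The properties of an ideal of quadrics from which the Hilbert–Kunz function is computed. -/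
structure IsGood (p : ℕ) (Q : Ideal (MvPolynomial (Fin 4) k)) : Prop where
  graded : IsGraded Q
  rel : HasQuadraticRelations Q
  indep : StdIndependent Q
  noSmallSyzygy : ∀ e, NoSmallSyzygy Q (p ^ e)

theorem tendsto_of_isGood {p : ℕ} (hp : 1 < p) {Q : Ideal (MvPolynomial (Fin 4) k)}
    (hQ : IsGood p Q) :
    Tendsto (fun e : ℕ => (Module.finrank k (MvPolynomial (Fin 4) k ⧸ Q ⊔ powIdeal k (p ^ e)) : ℝ) /
      (p : ℝ) ^ (2 * e)) atTop (nhds (8 / 3)) := by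
  have hpq : Tendsto (fun e : ℕ => p ^ e) atTop atTop := tendsto_pow_atTop_atTop_of_one_lt hp
  have hpr : Tendsto (fun e : ℕ => ((p ^ e : ℕ) : ℝ)) atTop atTop :=
    tendsto_natCast_atTop_atTop.comp hpq
  rw [tendsto_iff_dist_tendsto_zero]
  have hlim : Tendsto (fun e : ℕ => ((9 * (hilb Q 0 + hilb Q 1) + 200 : ℝ) / 3) / ((p ^ e : ℕ) : ℝ))
      atTop (nhds 0) := hpr.const_div_atTop _
  refine squeeze_zero' (Eventually.of_forall fun e => dist_nonneg) ?_ hlim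
  filter_upwards [hpq.eventually_ge_atTop 7] with e he
  have hcount := abs_three_mul_sum_sub_le (j := hilb (Q ⊔ powIdeal k (p ^ e))) (h := hilb Q) he
    (hilb_eq_four_mul hQ.rel hQ.indep) (fun m hm => hilb_sup_powIdeal_of_lt hQ.graded hm)
    (fun n hn => hilb_sup_powIdeal_add hQ.graded (hQ.noSmallSyzygy e) hn)
    (fun m hm => hilb_succ_le hQ.rel (by omega) hm)
  have hfin := finrank_quotient_eq_sum_hilb (hQ.graded.sup_powIdeal (p ^ e)) (M := 4 * p ^ e)
    fun m hm x hx => Ideal.mem_sup_right (mem_powIdeal_of_isHomogeneous hm hx)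
  have hcount' : |3 * (Module.finrank k (MvPolynomial (Fin 4) k ⧸ Q ⊔ powIdeal k (p ^ e)) : ℝ) -
      8 * ((p ^ e : ℕ) : ℝ) ^ 2| ≤ (9 * (hilb Q 0 + hilb Q 1) + 200) * ((p ^ e : ℕ) : ℝ) := by
    rw [hfin]; exact_mod_cast hcount
  generalize (Module.finrank k (MvPolynomial (Fin 4) k ⧸ Q ⊔ powIdeal k (p ^ e)) : ℝ) = F at *
  rw [Real.dist_eq, show (p : ℝ) ^ (2 * e) = ((p ^ e : ℕ) : ℝ) ^ 2 by push_cast; ring]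
  have hpos : (0 : ℝ) < ((p ^ e : ℕ) : ℝ) := by exact_mod_cast (by omega : 0 < p ^ e)
  generalize ((p ^ e : ℕ) : ℝ) = q at *
  have : F / q ^ 2 - 8 / 3 = (3 * F - 8 * q ^ 2) / (3 * q ^ 2) := by field_simp
  rw [this, abs_div, abs_of_pos (by positivity : (0 : ℝ) < 3 * q ^ 2), div_le_div_iff₀ (by positivity) hpos]
  calc _ ≤ (9 * (hilb Q 0 + hilb Q 1) + 200) * q * q := by gcongr
    _ = _ := by ring

end Asymptotics

section CubicEmbedding

open MvPolynomial

variable {k : Type*} [Field k]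

theorem eq_zero_of_expand_add {A B : MvPolynomial (Fin 2) k}
    (h : expand 2 A + X 0 * (X 1 * expand 2 B) = 0) : A = 0 ∧ B = 0 := by
  have hA : A = 0 := by
    ext d
    have h1 := congrArg (coeff (2 • d)) h
    rw [coeff_add, coeff_expand_smul _ two_ne_zero, coeff_X_mul', coeff_X_mul'] at h1
    rw [coeff_zero] at h1
    rw [coeff_zero, ← h1]
    split_ifs with h2 h3
    · rw [coeff_expand_of_not_dvd (i := 0), add_zero]
      have : 2 * d 0 ≠ 0 := by simpa using h2
      simp; omega
    · simp
    · simp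
  refine ⟨hA, ?_⟩
  simpa [hA, X_ne_zero, expand_eq_zero] using h

theorem eq_zero_of_forall_eval [IsAlgClosed k] {A B : MvPolynomial (Fin 2) k}
    (h : ∀ s t : k, t ≠ 0 → eval ![s ^ 4, t ^ 2] A + s ^ 2 * t * eval ![s ^ 4, t ^ 2] B = 0) :
    A = 0 ∧ B = 0 := by
  refine eq_zero_of_expand_add ((mul_eq_zero.1 ?_).resolve_left (X_ne_zero (1 : Fin 2)))
  refine MvPolynomial.funext fun x => ?_
  rcases eq_or_ne (x 1) 0 with hx | hx
  · simp [hx]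
  obtain ⟨s, hs⟩ := IsAlgClosed.exists_pow_nat_eq (x 0) (n := 2) (by norm_num)
  have h1 := h s (x 1) hx
  have h2 : x ^ 2 = ![s ^ 4, x 1 ^ 2] := by
    ext i; fin_cases i
    · simp [← hs]; ring
    · simp
  simp only [map_mul, map_add, eval_X, eval_expand, h2, map_zero]
  rw [← hs]
  linear_combination x 1 * h1

variable (a₁ a₃ : k)

/-- The ideal of an elliptic quartic with a rational `3`-torsion point. -/
noncomputable def cubicIdeal : Ideal (MvPolynomial (Fin 4) k) :=
  Ideal.span {X 2 ^ 2 - X 0 * X 1, X 3 ^ 2 + C a₁ * X 2 * X 3 + C a₃ * X 0 * X 3 - X 1 * X 2}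

theorem cubicIdeal_hasQuadraticRelations : HasQuadraticRelations (cubicIdeal a₁ a₃) where
  rel₂ := ⟨X 0 * X 1, (isHomogeneous_X _ _).mul (isHomogeneous_X _ _),
    Ideal.subset_span (by simp)⟩
  rel₃ := ⟨0, X 1, -C a₃ * X 0, -a₁, isHomogeneous_zero _ _ _, isHomogeneous_X _ _,
    by rw [← C_neg]; exact isHomogeneous_C_mul_X _ _, Ideal.subset_span (by simp; right; ring)⟩

namespace CubicRing

/-- The quartic model inside the coordinate ring of the plane cubic. -/
noncomputable def ofQuartic : MvPolynomial (Fin 4) k →ₐ[k] CubicRing a₁ a₃ :=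
  aeval ![z a₁ a₃ ^ 4, u a₁ a₃ ^ 2 * v a₁ a₃ ^ 2, z a₁ a₃ ^ 2 * u a₁ a₃ * v a₁ a₃,
    z a₁ a₃ * v a₁ a₃ ^ 3]

theorem cubicIdeal_le_ker : cubicIdeal a₁ a₃ ≤ RingHom.ker (ofQuartic a₁ a₃) := by
  have h := u_pow_three a₁ a₃
  rw [cubicIdeal, Ideal.span_le]
  rintro _ (rfl | rfl)
  · simp only [SetLike.mem_coe, RingHom.mem_ker, ofQuartic, map_sub, map_mul, map_pow, aeval_X]
    simp
    ring
  · simp only [SetLike.mem_coe, RingHom.mem_ker, ofQuartic, map_sub, map_add, map_mul, map_pow,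
      aeval_X, ← algebraMap_eq, AlgHom.commutes]
    simp
    linear_combination -z a₁ a₃ ^ 2 * v a₁ a₃ ^ 3 * h

variable {a₁ a₃}

theorem ofQuartic_binary (A : MvPolynomial (Fin 2) k) : ofQuartic a₁ a₃ (binary A) =
    aeval ![z a₁ a₃ ^ 4, (u a₁ a₃ * v a₁ a₃) ^ 2] A := by
  rw [ofQuartic, aeval_rename]
  congr 2
  ext i; fin_cases i
  · simp
  · simp; ring

theorem eq_zero_of_aeval_add [IsAlgClosed k] {A B : MvPolynomial (Fin 2) k}
    (h : aeval ![z a₁ a₃ ^ 4, (u a₁ a₃ * v a₁ a₃) ^ 2] A + z a₁ a₃ ^ 2 * (u a₁ a₃ * v a₁ a₃) *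
      aeval ![z a₁ a₃ ^ 4, (u a₁ a₃ * v a₁ a₃) ^ 2] B = 0) : A = 0 ∧ B = 0 := by
  refine eq_zero_of_forall_eval fun s t ht => ?_
  obtain ⟨c, hc⟩ : ∃ c : k, c ^ 2 - (a₁ * s * t + a₃ * s ^ 3) * c - t ^ 3 = 0 := by
    have := IsAlgClosed.exists_root
      (Polynomial.X ^ 2 - Polynomial.C (a₁ * s * t + a₃ * s ^ 3) * Polynomial.X -
        Polynomial.C (t ^ 3)) (by
          rw [show Polynomial.degree _ = 2 by compute_degree!]; norm_num)
    simpa [Polynomial.IsRoot] using this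
  have hc0 : c ≠ 0 := by
    rintro rfl
    exact ht (by simpa using hc)
  obtain ⟨u', hu⟩ := IsAlgClosed.exists_pow_nat_eq c (n := 3) (by norm_num)
  have hu0 : u' ≠ 0 := by rintro rfl; exact hc0 (by simpa using hu.symm)
  have hrel : u' ^ 3 = (t / u') ^ 3 + algebraMap k k a₁ * u' * (t / u') * s +
      algebraMap k k a₃ * s ^ 3 := by
    simp only [Algebra.algebraMap_self, RingHom.id_apply]
    field_simp
    rw [← hu] at hc
    linear_combination hc
  have h1 := congrArg (lift s (t / u') u' hrel) h
  have huv : u' * (t / u') = t := by field_simp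
  have h2 : ∀ A : MvPolynomial (Fin 2) k, lift s (t / u') u' hrel
      (aeval ![z a₁ a₃ ^ 4, (u a₁ a₃ * v a₁ a₃) ^ 2] A) = eval ![s ^ 4, t ^ 2] A := by
    intro A
    rw [← AlgHom.comp_apply, comp_aeval, ← coe_aeval_eq_eval]
    change aeval _ A = aeval _ A
    congr 2
    ext i; fin_cases i <;> simp [huv]
  simpa only [map_add, map_mul, map_pow, h2, lift_z, lift_u, lift_v, huv, map_zero] using h1

theorem eq_zero_of_ofQuartic_stdForm [IsAlgClosed k] (h₁ : a₁ ^ 3 ≠ 27 * a₃) (h₃ : a₃ ≠ 0)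
    {A B C D : MvPolynomial (Fin 2) k} (h : ofQuartic a₁ a₃ (stdForm A B C D) = 0) :
    A = 0 ∧ B = 0 ∧ C = 0 ∧ D = 0 := by
  have := isDomain _ _ h₁
  have hrel := u_pow_three a₁ a₃
  simp only [stdForm, map_add, map_mul, ofQuartic_binary] at h
  simp only [ofQuartic, aeval_X] at h
  let ev := fun A : MvPolynomial (Fin 2) k =>
    aeval ![z a₁ a₃ ^ 4, (u a₁ a₃ * v a₁ a₃) ^ 2] A
  have hE : (ev A + z a₁ a₃ ^ 2 * (u a₁ a₃ * v a₁ a₃) * ev B) + v a₁ a₃ ^ 3 * (z a₁ a₃ *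
      (ev C + z a₁ a₃ ^ 2 * (u a₁ a₃ * v a₁ a₃) * ev D)) = 0 := by
    rw [← h]; simp [ev]; ring
  let ι : CubicRing a₁ a₃ →ₐ[k] CubicRing a₁ a₃ :=
    lift (z a₁ a₃) (-u a₁ a₃) (-v a₁ a₃) (by linear_combination hrel)
  have hev : ∀ A, ι (ev A) = ev A := by
    intro A
    simp only [ev]
    rw [← AlgHom.comp_apply, comp_aeval]
    congr 2
    ext i; fin_cases i
    · simp [ι]
    · simp [ι]; ring
  have hE2 := congrArg ι hE
  simp only [map_add, map_mul, map_pow, hev, map_zero] at hE2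
  simp only [ι, lift_z, lift_u, lift_v] at hE2
  have hne : u a₁ a₃ ^ 3 + v a₁ a₃ ^ 3 ≠ 0 := by
    intro h0
    obtain ⟨c, hc⟩ := IsAlgClosed.exists_pow_nat_eq a₃ (n := 3) (by norm_num)
    have := congrArg (lift (S := k) 1 0 c (by simp [hc])) h0
    simp [hc, h₃] at this
  have hF : (u a₁ a₃ ^ 3 + v a₁ a₃ ^ 3) * (z a₁ a₃ *
      (ev C + z a₁ a₃ ^ 2 * (u a₁ a₃ * v a₁ a₃) * ev D)) = 0 := by
    linear_combination hE - hE2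
  have hF' := (mul_eq_zero.1 hF).resolve_left hne
  rw [hF', mul_zero, add_zero] at hE
  obtain ⟨rfl, rfl⟩ := eq_zero_of_aeval_add hE
  obtain ⟨rfl, rfl⟩ := eq_zero_of_aeval_add ((mul_eq_zero.1 hF').resolve_left z_ne_zero)
  simp

theorem mem_cubicIdeal_of_isHomogeneous [IsAlgClosed k] (h₁ : a₁ ^ 3 ≠ 27 * a₃) (h₃ : a₃ ≠ 0)
    {m : ℕ} {b : MvPolynomial (Fin 4) k} (hb : b.IsHomogeneous m) (h : ofQuartic a₁ a₃ b = 0) :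
    b ∈ cubicIdeal a₁ a₃ := by
  obtain ⟨A, B, C, D, -, -, -, -, hmem⟩ :=
    isStd_of_isHomogeneous (cubicIdeal_hasQuadraticRelations a₁ a₃) hb
  have h0 : ofQuartic a₁ a₃ (b - stdForm A B C D) = 0 := cubicIdeal_le_ker a₁ a₃ hmem
  rw [map_sub, h, zero_sub, neg_eq_zero] at h0
  obtain ⟨rfl, rfl, rfl, rfl⟩ := eq_zero_of_ofQuartic_stdForm h₁ h₃ h0
  simpa [stdForm] using hmem

/-- The grading of the cubic ring as a coaction. -/
noncomputable def coaction : CubicRing a₁ a₃ →ₐ[k] Polynomial (CubicRing a₁ a₃) :=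
  lift (Polynomial.C (z a₁ a₃) * Polynomial.X) (Polynomial.C (v a₁ a₃) * Polynomial.X)
    (Polynomial.C (u a₁ a₃) * Polynomial.X) (by
    have h := congrArg (Polynomial.C (R := CubicRing a₁ a₃)) (u_pow_three a₁ a₃)
    simp only [map_add, map_mul, map_pow] at h
    have hc : ∀ c : k, algebraMap k (Polynomial (CubicRing a₁ a₃)) c =
      Polynomial.C (algebraMap k _ c) := fun c => rfl
    rw [hc, hc]
    linear_combination Polynomial.X ^ 3 * h)

theorem coaction_ofQuartic {m : ℕ} {b : MvPolynomial (Fin 4) k} (hb : b.IsHomogeneous m) :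
    coaction (ofQuartic a₁ a₃ b) = Polynomial.C (ofQuartic a₁ a₃ b) * Polynomial.X ^ (4 * m) := by
  rw [b.as_sum, map_sum, map_sum, map_sum, Finset.sum_mul]
  refine Finset.sum_congr rfl fun d hd => ?_
  have hdeg : d.degree = m := by
    rw [Finsupp.degree_eq_weight_one]
    exact hb (mem_support_iff.1 hd)
  simp only [Finsupp.degree_eq_sum, Fin.sum_univ_four] at hdeg
  rw [ofQuartic, aeval_monomial, Finsupp.prod_fintype _ _ (by simp), Fin.prod_univ_four]
  have hc : ∀ c : k, coaction (algebraMap k (CubicRing a₁ a₃) c) =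
    Polynomial.C (algebraMap k (CubicRing a₁ a₃) c) := fun c => AlgHom.commutes _ _
  simp only [map_mul, map_pow, hc]
  simp [coaction, ← hdeg]
  ring

variable [IsAlgClosed k] {p : ℕ} [CharP k p]

theorem noSmallSyzygy_cubicIdeal (hp : p.Prime) (hp3 : p ≠ 3) (h₁ : a₁ ^ 3 ≠ 27 * a₃)
    (h₃ : a₃ ≠ 0) (e : ℕ) : NoSmallSyzygy (cubicIdeal a₁ a₃) (p ^ e) := by
  intro n hn b hb hsum
  have := isDomain _ _ h₁
  have := Fact.mk hp
  have : CharP (CubicRing a₁ a₃) p := charP_of_injective_algebraMap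
    (algebraMap k (CubicRing a₁ a₃)).injective p
  have h3k : (3 : k) ≠ 0 := by
    intro h
    have h' : ((3 : ℕ) : k) = 0 := by exact_mod_cast h
    exact hp3 ((Nat.prime_dvd_prime_iff_eq hp Nat.prime_three).1
      ((CharP.cast_eq_zero_iff k p 3).1 h'))
  obtain ⟨ω, hω⟩ : ∃ ω : k, ω ^ 2 + ω + 1 = 0 := by
    have := IsAlgClosed.exists_root
      (Polynomial.X ^ 2 + Polynomial.X + 1 : Polynomial k) (by
          rw [show Polynomial.degree _ = 2 by compute_degree!]; norm_num)
    simpa [Polynomial.IsRoot] using this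
  let q := p ^ e
  let c : k →+* CubicRing a₁ a₃ := algebraMap k _
  have hωR : c ω ^ 2 + c ω + 1 = 0 := by
    rw [← map_pow, ← map_add, ← map_one c, ← map_add, hω, map_zero]
  have hω3 : c ω ^ 3 = 1 := by linear_combination (c ω - 1) * hωR
  have hrel := u_pow_three a₁ a₃
  have hker := cubicIdeal_le_ker a₁ a₃ hsum
  simp only [RingHom.mem_ker, Fin.sum_univ_four, map_add, map_mul, map_pow] at hker
  have hX0 : ofQuartic a₁ a₃ (X 0) = z a₁ a₃ ^ 4 := by simp [ofQuartic]
  have hX1 : ofQuartic a₁ a₃ (X 1) = u a₁ a₃ ^ 2 * v a₁ a₃ ^ 2 := by simp [ofQuartic]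
  have hX2 : ofQuartic a₁ a₃ (X 2) = z a₁ a₃ ^ 2 * u a₁ a₃ * v a₁ a₃ := by simp [ofQuartic]
  have hX3 : ofQuartic a₁ a₃ (X 3) = z a₁ a₃ * v a₁ a₃ ^ 3 := by simp [ofQuartic]
  rw [hX0, hX1, hX2, hX3] at hker
  let σ : CubicRing a₁ a₃ →ₐ[k] CubicRing a₁ a₃ := lift (z a₁ a₃) (c ω * v a₁ a₃) (c ω ^ 2 * u a₁ a₃) (by
    linear_combination hrel + (c ω ^ 3 + 1) * u a₁ a₃ ^ 3 * hω3 - v a₁ a₃ ^ 3 * hω3 -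
      algebraMap k _ a₁ * u a₁ a₃ * v a₁ a₃ * z a₁ a₃ * hω3)
  have hσz : σ (z a₁ a₃) = z a₁ a₃ := lift_z _
  have hσv : σ (v a₁ a₃) = c ω * v a₁ a₃ := lift_v _
  have hσu : σ (u a₁ a₃) = c ω ^ 2 * u a₁ a₃ := lift_u _
  have hσ : ∀ x, σ (ofQuartic a₁ a₃ x) = ofQuartic a₁ a₃ x := by
    intro x
    rw [ofQuartic, ← AlgHom.comp_apply, comp_aeval]
    congr 2
    ext i; fin_cases i
    · simp [hσz]
    · simp [hσu, hσv]; linear_combination u a₁ a₃ ^ 2 * v a₁ a₃ ^ 2 * (c ω ^ 3 + 1) * hω3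
    · simp [hσz, hσu, hσv]; linear_combination z a₁ a₃ ^ 2 * u a₁ a₃ * v a₁ a₃ * hω3
    · simp [hσz, hσv, mul_pow, hω3]
  have key := coeffs_eq_zero_of_syzygy (R := CubicRing a₁ a₃) (Z := z a₁ a₃ ^ q) (U := u a₁ a₃ ^ q)
    (V := v a₁ a₃ ^ q) (A₁ := c a₁ ^ q) (A₃ := c a₃ ^ q) ?_ (pow_ne_zero _ z_ne_zero)
    (pow_ne_zero _ u_ne_zero) (pow_ne_zero _ v_ne_zero)
    (pow_ne_zero _ ((map_ne_zero_iff c c.injective).2 h₃))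
    (fun y => z_dvd_of_dvd_u_mul q) (fun y => z_dvd_of_dvd_v_mul q)
    (fun y => v_dvd_of_dvd_z_mul q) (fun y => v_dvd_of_dvd_u_mul h₃ q)
    (by have := (isUnit_iff_ne_zero.2 h3k).map c; rwa [map_ofNat] at this)
    (q := q) (m := 4 * n) (by omega) coaction.toRingHom ?_ ?_ ?_ ?_ σ.toRingHom (η := c (ω ^ q))
    ?_ ?_ ?_ ?_ ?_ ?_ ?_ (b₀ := ofQuartic a₁ a₃ (b 0)) (b₁ := ofQuartic a₁ a₃ (b 2))
    (b₂ := ofQuartic a₁ a₃ (b 3)) (b₃ := ofQuartic a₁ a₃ (b 1))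
    (coaction_ofQuartic (hb 0)) (coaction_ofQuartic (hb 3)) (coaction_ofQuartic (hb 1))
    (hσ _) (hσ _) (hσ _) ?_
  · obtain ⟨h0, h2, h3, h1⟩ := key
    intro i
    refine mem_cubicIdeal_of_isHomogeneous h₁ h₃ (hb i) ?_
    fin_cases i <;> assumption
  · have := congrArg (fun x => x ^ q) hrel
    simp only [q, add_pow_char_pow, mul_pow] at this
    rw [pow_right_comm, this]; ring
  · simp [coaction, mul_pow]
  · simp [coaction, mul_pow]
  · simp [coaction, mul_pow]
  · rw [← map_pow]; exact coaction.commutes _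
  · rw [← map_pow, ← map_add, ← map_one c, ← map_add, pow_right_comm]
    have := congrArg (fun x => x ^ q) hω
    simp only [q, add_pow_char_pow, one_pow] at this
    rw [this, zero_pow (pow_ne_zero _ hp.ne_zero), map_zero]
  · exact σ.commutes _
  · simp [hσz]
  · simp [hσu, mul_pow]; exact Or.inl (by ring)
  · simp [hσv, mul_pow]
  · rw [← map_pow]; exact σ.commutes _
  · exact coaction.commutes _
  · linear_combination hker

end CubicRing

theorem IsGraded.span_pair {f g : MvPolynomial (Fin 4) k} {n : ℕ} (hf : f.IsHomogeneous n)
    (hg : g.IsHomogeneous n) : IsGraded (Ideal.span {f, g}) := by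
  intro m x hx
  obtain ⟨a, b, rfl⟩ := Ideal.mem_span_pair.1 hx
  rw [map_add, homogeneousComponent_mul_of_isHomogeneous hf,
    homogeneousComponent_mul_of_isHomogeneous hg]
  split_ifs
  · exact Ideal.mem_span_pair.2 ⟨_, _, rfl⟩
  · simp

theorem isGood_cubicIdeal [IsAlgClosed k] {p : ℕ} [CharP k p] (hp : p.Prime) (hp3 : p ≠ 3)
    {a₁ a₃ : k} (h₁ : a₁ ^ 3 ≠ 27 * a₃) (h₃ : a₃ ≠ 0) : IsGood p (cubicIdeal a₁ a₃) where
  graded := by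
    have hX := isHomogeneous_X k (σ := Fin 4)
    refine IsGraded.span_pair (n := 2) (((hX 2).pow 2).sub ((hX 0).mul (hX 1))) ?_
    exact ((((hX 3).pow 2).add ((((hX 2).C_mul a₁)).mul (hX 3))).add
      (((hX 0).C_mul a₃).mul (hX 3))).sub ((hX 1).mul (hX 2))
  rel := cubicIdeal_hasQuadraticRelations a₁ a₃
  indep := fun A B C D h => CubicRing.eq_zero_of_ofQuartic_stdForm h₁ h₃
    (CubicRing.cubicIdeal_le_ker a₁ a₃ h)
  noSmallSyzygy := CubicRing.noSmallSyzygy_cubicIdeal hp hp3 h₁ h₃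

end CubicEmbedding

section DiagonalSyzygy

theorem eq_zero_of_dvd_of_coaction {R : Type*} [CommRing R] (φ : R →+* Polynomial R) {a c : ℕ}
    (hac : c < a) {d x : R} (hd : ∀ y, d * y = 0 → y = 0)
    (hφd : φ d = Polynomial.C d * Polynomial.X ^ a)
    (hφx : φ x = Polynomial.C x * Polynomial.X ^ c) (hdx : d ∣ x) : x = 0 := by
  obtain ⟨w, rfl⟩ := hdx
  rw [eq_zero_of_coaction φ hac (x := w), mul_zero]
  rw [map_mul, hφd, map_mul] at hφx
  rw [← sub_eq_zero]
  ext i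
  refine hd _ ?_
  rw [← Polynomial.coeff_C_mul, show Polynomial.C d * (φ w * Polynomial.X ^ a -
    Polynomial.C w * Polynomial.X ^ c) = 0 by linear_combination hφx, Polynomial.coeff_zero]

/-- The core vanishing statement on the curve `X₂² = X₀² + MX₁²`, `X₃² = X₀² + NX₁²`. -/
theorem coeffs_eq_zero_of_diagonal_syzygy {R : Type*} [CommRing R] {X₀ X₁ X₂ X₃ M N : R}
    (h₂ : X₂ ^ 2 = X₀ ^ 2 + M * X₁ ^ 2) (h₃ : X₃ ^ 2 = X₀ ^ 2 + N * X₁ ^ 2)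
    (hM : IsUnit M) (hMN : IsUnit (M - N))
    (r₀ : ∀ y, X₀ * y = 0 → y = 0) (r₁ : ∀ y, X₁ * y = 0 → y = 0)
    (r₂ : ∀ y, (X₀ ^ 2 + M * X₁ ^ 2) * y = 0 → y = 0)
    (d₁₀ : ∀ y, X₁ ∣ X₀ * y → X₁ ∣ y) (d₁₀' : ∀ y, X₁ ^ 2 ∣ X₀ ^ 2 * y → X₁ ^ 2 ∣ y)
    (d₀₂ : ∀ y, X₀ ∣ (X₀ ^ 2 + M * X₁ ^ 2) * y → X₀ ∣ y)
    (d₀₃ : ∀ y, X₀ ∣ (X₀ ^ 2 + N * X₁ ^ 2) * y → X₀ ∣ y)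
    (d₁₂ : ∀ y, X₁ ∣ (X₀ ^ 2 + M * X₁ ^ 2) * y → X₁ ∣ y)
    {q n : ℕ} (hn : n < q) (φ : R →+* Polynomial R)
    (φ₀ : φ X₀ = Polynomial.C X₀ * Polynomial.X ^ q)
    (φ₁ : φ X₁ = Polynomial.C X₁ * Polynomial.X ^ q)
    (φ₂ : φ X₂ = Polynomial.C X₂ * Polynomial.X ^ q)
    (φ₃ : φ X₃ = Polynomial.C X₃ * Polynomial.X ^ q)
    (φM : φ M = Polynomial.C M) (φN : φ N = Polynomial.C N) {b₀ b₁ b₂ b₃ : R}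
    (φb₀ : φ b₀ = Polynomial.C b₀ * Polynomial.X ^ n)
    (φb₂ : φ b₂ = Polynomial.C b₂ * Polynomial.X ^ n)
    (φb₃ : φ b₃ = Polynomial.C b₃ * Polynomial.X ^ n)
    (h : b₀ * X₀ ^ 3 + b₁ * X₁ ^ 3 + b₂ * X₂ ^ 3 + b₃ * X₃ ^ 3 = 0) :
    b₀ = 0 ∧ b₁ = 0 ∧ b₂ = 0 ∧ b₃ = 0 := by
  have hM0 : ∀ y, M * y = 0 → y = 0 := fun y hy => (hM.mul_right_eq_zero).1 hy
  have hMN0 : ∀ y, (M - N) * y = 0 → y = 0 := fun y hy => (hMN.mul_right_eq_zero).1 hy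
  have e : X₀ ^ 2 * (b₀ * X₀ + b₂ * X₂ + b₃ * X₃) +
      X₁ ^ 2 * (b₁ * X₁ + M * b₂ * X₂ + N * b₃ * X₃) = 0 := by
    linear_combination h - b₂ * X₂ * h₂ - b₃ * X₃ * h₃
  have e₁ : b₀ * X₀ + b₂ * X₂ + b₃ * X₃ = 0 := by
    refine eq_zero_of_dvd_of_coaction φ (a := 2 * q) (c := n + q) (d := X₁ ^ 2) (by omega)
      (fun y hy => r₁ _ (r₁ _ (by linear_combination hy))) ?_ ?_
      (d₁₀' _ ⟨-(b₁ * X₁ + M * b₂ * X₂ + N * b₃ * X₃), by linear_combination e⟩)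
    · rw [map_pow, φ₁, map_pow]; ring
    · simp only [map_add, map_mul, φ₀, φ₂, φ₃, φb₀, φb₂, φb₃]; ring
  have e₂ : b₁ * X₁ + M * b₂ * X₂ + N * b₃ * X₃ = 0 :=
    r₁ _ (r₁ _ (by linear_combination e - X₀ ^ 2 * e₁))
  have e₃ : M * b₂ * X₃ + N * b₃ * X₂ = 0 := by
    have hd : X₀ ∣ M * b₂ * X₃ + N * b₃ * X₂ := by
      refine d₀₂ _ ⟨X₂ * (-M * b₀ * X₃ - M * b₃ * X₀ + N * b₃ * X₀), ?_⟩
      linear_combination X₂ * M * X₃ * e₁ - X₂ * M * b₃ * h₃ + X₂ * N * b₃ * h₂ -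
        (M * b₂ * X₃ + N * b₃ * X₂) * h₂
    obtain ⟨y, hy⟩ := hd
    have hd' : X₁ ∣ y := by
      refine d₁₀ _ (hy ▸ d₁₂ _ ⟨X₂ * (-b₁ * X₃ + N * M * b₃ * X₁ - N * N * b₃ * X₁), ?_⟩)
      linear_combination X₂ * X₃ * e₂ - X₂ * N * b₃ * h₃ + X₂ * N * b₃ * h₂ -
        (M * b₂ * X₃ + N * b₃ * X₂) * h₂
    obtain ⟨w, rfl⟩ := hd'
    refine eq_zero_of_dvd_of_coaction φ (a := 2 * q) (c := n + q) (d := X₀ * X₁) (by omega)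
      (fun y hy => r₁ _ (r₀ _ (by linear_combination hy))) ?_ ?_ ⟨w, by rw [hy, mul_assoc]⟩
    · rw [map_mul, φ₀, φ₁, map_mul]; ring
    · simp only [map_add, map_mul, φ₂, φ₃, φb₂, φb₃, φM, φN]; ring
  have e₄ : M * b₀ * X₃ + (M - N) * b₃ * X₀ = 0 := r₀ _ (by
    linear_combination M * X₃ * e₁ - X₂ * e₃ + N * b₃ * h₂ - M * b₃ * h₃)
  have hb₀ : b₀ = 0 := by
    refine eq_zero_of_dvd_of_coaction φ hn r₀ φ₀ φb₀ (d₀₃ _ ?_)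
    obtain ⟨m, hm⟩ := hM.exists_left_inv
    exact ⟨-m * (M - N) * b₃ * X₃, by
      linear_combination m * X₃ * e₄ - b₀ * h₃ - b₀ * X₃ ^ 2 * hm⟩
  subst hb₀
  have hb₃ : b₃ = 0 := hMN0 _ (r₀ _ (by linear_combination e₄))
  subst hb₃
  have hb₂ : b₂ = 0 := r₂ _ (by linear_combination X₂ * e₁ - b₂ * h₂)
  subst hb₂
  exact ⟨rfl, r₁ _ (by linear_combination e₂), rfl, rfl⟩

end DiagonalSyzygy

section SqrtRing

open Polynomial

variable {A : Type*} [CommRing A]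

/-- Adjoining a square root. -/
abbrev SqrtRing (s : A) : Type _ := AdjoinRoot (X ^ 2 - C s)

namespace SqrtRing

variable (s : A)

theorem root_sq : AdjoinRoot.root (X ^ 2 - C s) ^ 2 = algebraMap A (SqrtRing s) s := by
  have h : eval₂ (AdjoinRoot.of (X ^ 2 - C s)) (AdjoinRoot.root _) (X ^ 2 - C s) = 0 :=
    AdjoinRoot.eval₂_root _
  rw [eval₂_sub, eval₂_X_pow, eval₂_C, sub_eq_zero] at h
  exact h

instance : Module.Free A (SqrtRing s) :=
  Module.Free.of_basis (AdjoinRoot.powerBasis' (monic_X_pow_sub_C s two_ne_zero)).basis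

variable {s}

theorem eq_zero_of_add_mul_root [Nontrivial A] {a b : A} (h : algebraMap A (SqrtRing s) a +
    algebraMap A (SqrtRing s) b * AdjoinRoot.root (X ^ 2 - C s) = 0) : a = 0 ∧ b = 0 := by
  have hm : (X ^ 2 - C s).Monic := monic_X_pow_sub_C s two_ne_zero
  have h1 : AdjoinRoot.mk (X ^ 2 - C s) (C b * X + C a) = 0 := by
    rw [map_add, map_mul, AdjoinRoot.mk_C, AdjoinRoot.mk_C, AdjoinRoot.mk_X, add_comm]
    exact h
  rw [AdjoinRoot.mk_eq_zero] at h1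
  have h2 : C b * X + C a = 0 := by
    by_contra hne
    refine hm.not_dvd_of_degree_lt hne ?_ h1
    rw [degree_X_pow_sub_C two_pos]
    exact degree_linear_le.trans_lt (by norm_num)
  have e0 := congrArg (fun P => coeff P 0) h2
  have e1 := congrArg (fun P => coeff P 1) h2
  simpa [coeff_C] using And.intro e0 e1

/-- Extending a grading to a ring with an adjoined square root. -/
noncomputable def coaction (φ : A →+* A[X]) (hφ : φ s = C s * X ^ 2) :
    SqrtRing s →+* (SqrtRing s)[X] :=
  AdjoinRoot.lift ((mapRingHom (algebraMap A (SqrtRing s))).comp φ)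
    (C (AdjoinRoot.root (X ^ 2 - C s)) * X) (by
      rw [eval₂_sub, eval₂_X_pow, eval₂_C, RingHom.comp_apply, hφ, coe_mapRingHom,
        Polynomial.map_mul, map_C, Polynomial.map_pow, map_X, mul_pow, ← C_pow, root_sq, sub_self])

theorem coaction_root (φ : A →+* A[X]) (hφ : φ s = C s * X ^ 2) :
    coaction φ hφ (AdjoinRoot.root _) = C (AdjoinRoot.root _) * X :=
  AdjoinRoot.lift_root _

theorem coaction_algebraMap (φ : A →+* A[X]) (hφ : φ s = C s * X ^ 2) (a : A) :
    coaction φ hφ (algebraMap A _ a) = (φ a).map (algebraMap A _) :=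
  AdjoinRoot.lift_of _

end SqrtRing

end SqrtRing

section Diagonal

open MvPolynomial

variable {k : Type*} [Field k]

theorem coaction_aeval_of_isHomogeneous {σ R : Type*} [CommRing R] [Algebra k R]
    (φ : R →+* Polynomial R) (hφ : ∀ c : k, φ (algebraMap k R c) = Polynomial.C (algebraMap k R c))
    (y : σ → R) (hy : ∀ i, φ (y i) = Polynomial.C (y i) * Polynomial.X) {m : ℕ}
    {b : MvPolynomial σ k} (hb : b.IsHomogeneous m) :
    φ (aeval y b) = Polynomial.C (aeval y b) * Polynomial.X ^ m := by
  rw [b.as_sum, map_sum, map_sum, map_sum, Finset.sum_mul]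
  refine Finset.sum_congr rfl fun d hd => ?_
  have hdeg : d.degree = m := by
    rw [Finsupp.degree_eq_weight_one]
    exact hb (mem_support_iff.1 hd)
  rw [aeval_monomial, map_mul, map_mul, hφ, mul_assoc, Finsupp.prod, map_prod, map_prod, ← hdeg,
    Finsupp.degree_apply, ← Finset.prod_pow_eq_pow_sum, ← Finset.prod_mul_distrib]
  simp [hy, mul_pow]

theorem aeval_binary_eq_algebraMap {R : Type*} [CommRing R] [Algebra k R]
    [Algebra (MvPolynomial (Fin 2) k) R] [IsScalarTower k (MvPolynomial (Fin 2) k) R] (y z : R)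
    (A : MvPolynomial (Fin 2) k) :
    aeval (R := k) ![algebraMap (MvPolynomial (Fin 2) k) R (X 0),
      algebraMap (MvPolynomial (Fin 2) k) R (X 1), y, z] (binary A) =
      algebraMap (MvPolynomial (Fin 2) k) R A := by
  change _ = IsScalarTower.toAlgHom k (MvPolynomial (Fin 2) k) R A
  rw [← AlgHom.comp_apply]
  congr 1
  ext i
  fin_cases i <;> simp

/-- The coordinate ring of the elliptic quartic `x₂² = x₀² + μx₁²`, `x₃² = x₀² + νx₁²`. -/
abbrev DiagonalRing (μ ν : k) : Type _ :=
  SqrtRing (algebraMap (MvPolynomial (Fin 2) k) (SqrtRing (X 0 ^ 2 + C μ * X 1 ^ 2 :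
    MvPolynomial (Fin 2) k)) (X 0 ^ 2 + C ν * X 1 ^ 2))

namespace DiagonalRing

variable (μ ν : k)

local notation "𝓐" => MvPolynomial (Fin 2) k

instance : Module.Free 𝓐 (DiagonalRing μ ν) :=
  Module.Free.trans (S := SqrtRing (X 0 ^ 2 + C μ * X 1 ^ 2 : 𝓐))

/-- The square root of `x₀² + μx₁²`. -/
noncomputable def x₂ : DiagonalRing μ ν :=
  algebraMap (SqrtRing (X 0 ^ 2 + C μ * X 1 ^ 2 : 𝓐)) _ (AdjoinRoot.root _)

/-- The square root of `x₀² + νx₁²`. -/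
noncomputable def x₃ : DiagonalRing μ ν := AdjoinRoot.root _

theorem x₂_sq : x₂ μ ν ^ 2 = algebraMap 𝓐 _ (X 0 ^ 2 + C μ * X 1 ^ 2) := by
  rw [x₂, ← map_pow, SqrtRing.root_sq]
  exact (IsScalarTower.algebraMap_apply _ _ _ _).symm

theorem x₃_sq : x₃ μ ν ^ 2 = algebraMap 𝓐 _ (X 0 ^ 2 + C ν * X 1 ^ 2) := by
  rw [x₃, SqrtRing.root_sq]
  exact (IsScalarTower.algebraMap_apply _ _ _ _).symm

variable {μ ν}

theorem eq_zero_of_add {A B C D : 𝓐} (h : algebraMap 𝓐 (DiagonalRing μ ν) A +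
    algebraMap 𝓐 _ B * x₂ μ ν + algebraMap 𝓐 _ C * x₃ μ ν +
    algebraMap 𝓐 _ D * (x₂ μ ν * x₃ μ ν) = 0) : A = 0 ∧ B = 0 ∧ C = 0 ∧ D = 0 := by
  let S := SqrtRing (X 0 ^ 2 + MvPolynomial.C μ * X 1 ^ 2 : 𝓐)
  have hnt : Nontrivial S := AdjoinRoot.nontrivial _ (by
    rw [Polynomial.degree_X_pow_sub_C two_pos]; norm_num)
  have ht : ∀ a : 𝓐, algebraMap 𝓐 (DiagonalRing μ ν) a = algebraMap S _ (algebraMap 𝓐 S a) :=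
    fun a => IsScalarTower.algebraMap_apply _ _ _ _
  simp only [ht, x₂, x₃] at h
  obtain ⟨h1, h2⟩ := SqrtRing.eq_zero_of_add_mul_root (A := S)
    (a := algebraMap 𝓐 S A + algebraMap 𝓐 S B * AdjoinRoot.root _)
    (b := algebraMap 𝓐 S C + algebraMap 𝓐 S D * AdjoinRoot.root _) (by
      rw [← h]; simp only [map_add, map_mul]; ring)
  obtain ⟨rfl, rfl⟩ := SqrtRing.eq_zero_of_add_mul_root h1
  obtain ⟨rfl, rfl⟩ := SqrtRing.eq_zero_of_add_mul_root h2
  simp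

variable (μ ν)

/-- The standard grading of `k[x₀, x₁]` as a coaction. -/
noncomputable def baseCoaction : 𝓐 →+* Polynomial 𝓐 :=
  (aeval (R := k) fun i => Polynomial.C (X i : 𝓐) * Polynomial.X).toRingHom

theorem baseCoaction_X (i : Fin 2) :
    baseCoaction (k := k) (X i) = Polynomial.C (X i) * Polynomial.X := by
  simp [baseCoaction]

theorem baseCoaction_C (c : k) : baseCoaction (C c) = Polynomial.C (C c) := by
  simp only [baseCoaction, AlgHom.toRingHom_eq_coe, RingHom.coe_coe, aeval_C]
  rfl

theorem baseCoaction_quadric (c : k) : baseCoaction (X 0 ^ 2 + C c * X 1 ^ 2) =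
    Polynomial.C (X 0 ^ 2 + C c * X 1 ^ 2) * Polynomial.X ^ 2 := by
  simp only [map_add, map_mul, map_pow, baseCoaction_X, baseCoaction_C]
  ring

/-- The grading as a coaction. -/
noncomputable def coaction : DiagonalRing μ ν →+* Polynomial (DiagonalRing μ ν) :=
  SqrtRing.coaction (SqrtRing.coaction baseCoaction (baseCoaction_quadric μ)) (by
    rw [SqrtRing.coaction_algebraMap, baseCoaction_quadric, Polynomial.map_mul, Polynomial.map_C,
      Polynomial.map_pow, Polynomial.map_X])

theorem coaction_x₃ : coaction μ ν (x₃ μ ν) = Polynomial.C (x₃ μ ν) * Polynomial.X :=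
  SqrtRing.coaction_root _ _

theorem coaction_x₂ : coaction μ ν (x₂ μ ν) = Polynomial.C (x₂ μ ν) * Polynomial.X := by
  refine (SqrtRing.coaction_algebraMap _ _ _).trans ?_
  rw [SqrtRing.coaction_root, Polynomial.map_mul, Polynomial.map_C, Polynomial.map_X]
  rfl

theorem coaction_algebraMap (a : 𝓐) : coaction μ ν (algebraMap 𝓐 _ a) =
    (baseCoaction a).map (algebraMap 𝓐 _) := by
  refine (SqrtRing.coaction_algebraMap _ _ _).trans ?_
  refine (congrArg (Polynomial.map _) (SqrtRing.coaction_algebraMap _ _ a)).trans ?_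
  rw [Polynomial.map_map]
  rfl

theorem coaction_X (i : Fin 2) : coaction μ ν (algebraMap 𝓐 _ (X i)) =
    Polynomial.C (algebraMap 𝓐 _ (X i)) * Polynomial.X := by
  rw [coaction_algebraMap, baseCoaction_X, Polynomial.map_mul, Polynomial.map_C, Polynomial.map_X]

theorem coaction_C (c : k) :
    coaction μ ν (algebraMap k _ c) = Polynomial.C (algebraMap k _ c) := by
  rw [show algebraMap k (DiagonalRing μ ν) c = algebraMap 𝓐 _ (C c) from rfl,
    coaction_algebraMap, baseCoaction_C, Polynomial.map_C]

/-- The quotient map from the polynomial ring. -/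
noncomputable def ofQuartic : MvPolynomial (Fin 4) k →ₐ[k] DiagonalRing μ ν :=
  aeval ![algebraMap 𝓐 _ (X 0), algebraMap 𝓐 _ (X 1), x₂ μ ν, x₃ μ ν]

theorem coaction_ofQuartic {m : ℕ} {b : MvPolynomial (Fin 4) k} (hb : b.IsHomogeneous m) :
    coaction μ ν (ofQuartic μ ν b) = Polynomial.C (ofQuartic μ ν b) * Polynomial.X ^ m := by
  refine coaction_aeval_of_isHomogeneous _ (coaction_C μ ν) _ (fun i => ?_) hb
  fin_cases i
  · exact coaction_X μ ν 0
  · exact coaction_X μ ν 1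
  · exact coaction_x₂ μ ν
  · exact coaction_x₃ μ ν

theorem ofQuartic_binary (A : 𝓐) : ofQuartic μ ν (binary A) = algebraMap 𝓐 _ A :=
  aeval_binary_eq_algebraMap _ _ A

/-- The ideal of an elliptic quartic in diagonal form. -/
noncomputable def _root_.diagonalIdeal : Ideal (MvPolynomial (Fin 4) k) :=
  Ideal.span {X 2 ^ 2 - (X 0 ^ 2 + C μ * X 1 ^ 2), X 3 ^ 2 - (X 0 ^ 2 + C ν * X 1 ^ 2)}

theorem _root_.diagonalIdeal_hasQuadraticRelations :
    HasQuadraticRelations (diagonalIdeal μ ν) where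
  rel₂ := ⟨X 0 ^ 2 + C μ * X 1 ^ 2, (isHomogeneous_X_pow _ _).add ((isHomogeneous_X_pow _ _).C_mul _),
    Ideal.subset_span (by simp)⟩
  rel₃ := ⟨X 0 ^ 2 + C ν * X 1 ^ 2, 0, 0, 0,
    (isHomogeneous_X_pow _ _).add ((isHomogeneous_X_pow _ _).C_mul _),
    isHomogeneous_zero _ _ _, isHomogeneous_zero _ _ _, Ideal.subset_span (by simp)⟩

theorem diagonalIdeal_le_ker : diagonalIdeal μ ν ≤ RingHom.ker (ofQuartic μ ν) := by
  rw [diagonalIdeal, Ideal.span_le]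
  rintro _ (rfl | rfl)
  · rw [SetLike.mem_coe, RingHom.mem_ker, map_sub, map_pow, sub_eq_zero]
    refine Eq.trans ?_ ((x₂_sq μ ν).trans ?_)
    · simp [ofQuartic]
    · rw [← ofQuartic_binary]; simp
  · rw [SetLike.mem_coe, RingHom.mem_ker, map_sub, map_pow, sub_eq_zero]
    refine Eq.trans ?_ ((x₃_sq μ ν).trans ?_)
    · simp [ofQuartic]
    · rw [← ofQuartic_binary]; simp

variable {μ ν}

theorem eq_zero_of_ofQuartic_stdForm {A B C D : 𝓐} (h : ofQuartic μ ν (stdForm A B C D) = 0) :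
    A = 0 ∧ B = 0 ∧ C = 0 ∧ D = 0 := by
  simp only [stdForm, map_add, map_mul, ofQuartic_binary] at h
  simp only [ofQuartic, aeval_X] at h
  exact eq_zero_of_add h

theorem mem_diagonalIdeal_of_isHomogeneous {m : ℕ} {b : MvPolynomial (Fin 4) k}
    (hb : b.IsHomogeneous m) (h : ofQuartic μ ν b = 0) : b ∈ diagonalIdeal μ ν := by
  obtain ⟨A, B, C, D, -, -, -, -, hmem⟩ :=
    isStd_of_isHomogeneous (diagonalIdeal_hasQuadraticRelations μ ν) hb
  have h0 : ofQuartic μ ν (b - stdForm A B C D) = 0 := diagonalIdeal_le_ker μ ν hmem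
  rw [map_sub, h, zero_sub, neg_eq_zero] at h0
  obtain ⟨rfl, rfl, rfl, rfl⟩ := eq_zero_of_ofQuartic_stdForm h0
  simpa [stdForm] using hmem

end DiagonalRing

end Diagonal

section DiagonalNoSmallSyzygy

open MvPolynomial

variable {k : Type*} [Field k]

local notation "𝓐" => MvPolynomial (Fin 2) k

theorem isRelPrime_X_quadric {c : k} (i : Fin 2) (hc : i = 0 → c ≠ 0) (q : ℕ) :
    IsRelPrime (X i ^ q : 𝓐) ((X 0 ^ 2 + C c * X 1 ^ 2) ^ q) := by
  refine IsRelPrime.pow ?_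
  rw [X_prime.irreducible.isRelPrime_iff_not_dvd]
  rintro ⟨d, hd⟩
  have h := congrArg (eval (Pi.single (1 - i) 1)) hd
  fin_cases i
  · simp at h; exact hc rfl h
  · simp at h

theorem eq_zero_of_diagonal_syzygy [CharP k 3] {R : Type*} [CommRing R] [Algebra 𝓐 R]
    [Module.Free 𝓐 R] {μ ν : k} (hμ : μ ≠ 0) (hν : ν ≠ 0) (hμν : μ ≠ ν) {x₂ x₃ : R}
    (h₂ : x₂ ^ 2 = algebraMap 𝓐 R (X 0 ^ 2 + C μ * X 1 ^ 2))
    (h₃ : x₃ ^ 2 = algebraMap 𝓐 R (X 0 ^ 2 + C ν * X 1 ^ 2))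
    (φ : R →+* Polynomial R) (φX : ∀ i, φ (algebraMap 𝓐 R (X i)) =
      Polynomial.C (algebraMap 𝓐 R (X i)) * Polynomial.X)
    (φC : ∀ c, φ (algebraMap 𝓐 R (C c)) = Polynomial.C (algebraMap 𝓐 R (C c)))
    (φ₂ : φ x₂ = Polynomial.C x₂ * Polynomial.X) (φ₃ : φ x₃ = Polynomial.C x₃ * Polynomial.X)
    {e n : ℕ} (hn : n < 3 ^ e) {b₀ b₁ b₂ b₃ : R}
    (φb₀ : φ b₀ = Polynomial.C b₀ * Polynomial.X ^ n)
    (φb₂ : φ b₂ = Polynomial.C b₂ * Polynomial.X ^ n)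
    (φb₃ : φ b₃ = Polynomial.C b₃ * Polynomial.X ^ n)
    (h : b₀ * algebraMap 𝓐 R (X 0) ^ 3 ^ (e + 1) + b₁ * algebraMap 𝓐 R (X 1) ^ 3 ^ (e + 1) +
      b₂ * x₂ ^ 3 ^ (e + 1) + b₃ * x₃ ^ 3 ^ (e + 1) = 0) :
    b₀ = 0 ∧ b₁ = 0 ∧ b₂ = 0 ∧ b₃ = 0 := by
  have : Fact (Nat.Prime 3) := ⟨Nat.prime_three⟩
  set q := 3 ^ e with hq
  have hp : ∀ c : k, algebraMap 𝓐 R ((X 0 ^ 2 + C c * X 1 ^ 2) ^ q) =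
      algebraMap 𝓐 R (X 0 ^ q) ^ 2 + algebraMap 𝓐 R (C (c ^ q)) * algebraMap 𝓐 R (X 1 ^ q) ^ 2 := by
    intro c
    rw [hq, add_pow_char_pow, ← hq, mul_pow]
    simp only [map_add, map_mul, map_pow]
    ring
  have hr : ∀ a : 𝓐, a ≠ 0 → ∀ y : R, algebraMap 𝓐 R a * y = 0 → y = 0 := by
    intro a ha y hy
    rw [← Algebra.smul_def] at hy
    exact (smul_eq_zero.1 hy).resolve_left ha
  have hX : ∀ i : Fin 2, (X i ^ q : 𝓐) ≠ 0 := fun i => pow_ne_zero _ (X_ne_zero i)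
  have h10 : IsRelPrime (X 1 : 𝓐) (X 0) := CubicRing.isRelPrime_X (by decide)
  have hφX : ∀ i, φ (algebraMap 𝓐 R (X i ^ q)) =
      Polynomial.C (algebraMap 𝓐 R (X i ^ q)) * Polynomial.X ^ q := by
    intro i; rw [map_pow, map_pow, φX, mul_pow, map_pow]
  refine coeffs_eq_zero_of_diagonal_syzygy (X₀ := algebraMap 𝓐 R (X 0 ^ q))
    (X₁ := algebraMap 𝓐 R (X 1 ^ q)) (X₂ := x₂ ^ q) (X₃ := x₃ ^ q)
    (M := algebraMap 𝓐 R (C (μ ^ q))) (N := algebraMap 𝓐 R (C (ν ^ q)))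
    ?_ ?_ ?_ ?_ (hr _ (hX 0)) (hr _ (hX 1)) ?_ ?_ ?_ ?_ ?_ ?_ hn φ (hφX 0) (hφX 1)
    ?_ ?_ (φC _) (φC _) φb₀ φb₂ φb₃ ?_
  · rw [← hp, pow_right_comm, h₂, map_pow]
  · rw [← hp, pow_right_comm, h₃, map_pow]
  · exact ((isUnit_iff_ne_zero.2 (pow_ne_zero q hμ)).map C).map _
  · rw [← map_sub, ← map_sub, hq, ← sub_pow_char_pow]
    exact ((isUnit_iff_ne_zero.2 (pow_ne_zero _ (sub_ne_zero.2 hμν))).map C).map _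
  · rw [← hp]
    refine hr _ (pow_ne_zero _ fun h0 => ?_)
    have := congrArg (eval ![1, 0]) h0
    simp at this
  · exact fun y => algebraMap_dvd_of_dvd_mul h10.pow
  · intro y
    rw [← map_pow, ← map_pow]
    exact algebraMap_dvd_of_dvd_mul h10.pow.pow
  · rw [← hp]
    exact fun y => algebraMap_dvd_of_dvd_mul (isRelPrime_X_quadric 0 (fun _ => hμ) q)
  · rw [← hp]
    exact fun y => algebraMap_dvd_of_dvd_mul (isRelPrime_X_quadric 0 (fun _ => hν) q)
  · rw [← hp]
    exact fun y => algebraMap_dvd_of_dvd_mul (isRelPrime_X_quadric 1 (by simp) q)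
  · rw [map_pow, φ₂, mul_pow, map_pow]
  · rw [map_pow, φ₃, mul_pow, map_pow]
  · simpa only [map_pow, ← pow_mul, hq, ← pow_succ] using h

theorem noSmallSyzygy_diagonalIdeal [CharP k 3] {μ ν : k} (hμ : μ ≠ 0) (hν : ν ≠ 0)
    (hμν : μ ≠ ν) (e : ℕ) : NoSmallSyzygy (diagonalIdeal μ ν) (3 ^ e) := by
  intro n hn b hb hsum
  have hker := DiagonalRing.diagonalIdeal_le_ker μ ν hsum
  have hX0 : DiagonalRing.ofQuartic μ ν (X 0) = algebraMap 𝓐 _ (X 0) := aeval_X _ _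
  have hX1 : DiagonalRing.ofQuartic μ ν (X 1) = algebraMap 𝓐 _ (X 1) := aeval_X _ _
  have hX2 : DiagonalRing.ofQuartic μ ν (X 2) = DiagonalRing.x₂ μ ν := aeval_X _ _
  have hX3 : DiagonalRing.ofQuartic μ ν (X 3) = DiagonalRing.x₃ μ ν := aeval_X _ _
  simp only [RingHom.mem_ker, Fin.sum_univ_four, map_add, map_mul, map_pow, hX0, hX1, hX2,
    hX3] at hker
  have hb' := fun i => DiagonalRing.coaction_ofQuartic μ ν (hb i)
  rcases e with _ | e
  · obtain rfl : n = 0 := by omega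
    have hc : ∀ i, b i = C (coeff 0 (b i)) := fun i =>
      totalDegree_eq_zero_iff_eq_C.1 (Nat.le_zero.1 (hb i).totalDegree_le)
    generalize hd : (fun i => coeff 0 (b i)) = c at hc
    obtain rfl : b = fun i => C (c i) := _root_.funext fun i => by rw [hc i, ← hd]
    obtain ⟨hA, hB, hC, -⟩ := DiagonalRing.eq_zero_of_ofQuartic_stdForm (μ := μ) (ν := ν)
      (A := C (c 0) * X 0 + C (c 1) * X 1) (B := C (c 2))
      (C := C (c 3)) (D := 0) (DiagonalRing.diagonalIdeal_le_ker μ ν (by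
        convert hsum using 1
        simp [Fin.sum_univ_four, stdForm]))
    have h0 := congrArg (eval ![1, 0]) hA
    have h1 := congrArg (eval ![0, 1]) hA
    simp at h0 h1
    intro i
    have hi : c i = 0 := by
      fin_cases i
      exacts [h0, h1, C_eq_zero.1 hB, C_eq_zero.1 hC]
    simp [hi]
  · obtain ⟨h0, h1, h2, h3⟩ := eq_zero_of_diagonal_syzygy hμ hν hμν (DiagonalRing.x₂_sq μ ν)
      (DiagonalRing.x₃_sq μ ν) (DiagonalRing.coaction μ ν) (DiagonalRing.coaction_X μ ν)
      (fun c => DiagonalRing.coaction_C μ ν c) (DiagonalRing.coaction_x₂ μ ν)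
      (DiagonalRing.coaction_x₃ μ ν) (by omega : n < 3 ^ e) (hb' 0) (hb' 2) (hb' 3) hker
    intro i
    refine DiagonalRing.mem_diagonalIdeal_of_isHomogeneous (hb i) ?_
    fin_cases i <;> assumption

theorem isGood_diagonalIdeal [CharP k 3] {μ ν : k} (hμ : μ ≠ 0) (hν : ν ≠ 0)
    (hμν : μ ≠ ν) : IsGood 3 (diagonalIdeal μ ν) where
  graded := by
    have hX := isHomogeneous_X k (σ := Fin 4)
    refine IsGraded.span_pair (n := 2) ?_ ?_ <;>
    exact ((hX _).pow 2).sub (((hX 0).pow 2).add (((hX 1).pow 2).C_mul _))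
  rel := diagonalIdeal_hasQuadraticRelations μ ν
  indep := fun A B C D h => DiagonalRing.eq_zero_of_ofQuartic_stdForm
    (DiagonalRing.diagonalIdeal_le_ker μ ν h)
  noSmallSyzygy := noSmallSyzygy_diagonalIdeal hμ hν hμν

end DiagonalNoSmallSyzygy

section QuadraticForms

open MvPolynomial

variable {k : Type*} [Field k]

theorem MvPolynomial.IsHomogeneous.exists_quadraticForm {σ : Type*} [Fintype σ] [DecidableEq σ]
    {f : MvPolynomial σ k} (hf : f.IsHomogeneous 2) : ∃ Q : QuadraticForm k (σ → k), ∀ x, Q x = eval x f ∧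
      ∀ y, QuadraticMap.polar Q x y = ∑ i, eval x (pderiv i f) * y i := by
  have h : f ∈ homogeneousSubmodule σ k 1 ^ 2 := by rwa [homogeneousSubmodule_one_pow]
  rw [homogeneousSubmodule_one_eq_span_X, pow_two, Submodule.span_mul_span] at h
  clear hf
  induction h using Submodule.span_induction with
  | mem f hf =>
    obtain ⟨_, ⟨i, rfl⟩, _, ⟨j, rfl⟩, rfl⟩ := hf
    refine ⟨QuadraticMap.linMulLin (LinearMap.proj i) (LinearMap.proj j), fun x => ⟨by simp, ?_⟩⟩
    intro y
    simp [QuadraticMap.polar, Pi.single_apply, add_mul, Finset.sum_add_distrib, pderiv_X,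
      apply_ite (eval x), ite_mul]
    ring
  | zero => exact ⟨0, by simp [QuadraticMap.polar]⟩
  | add f g _ _ hf hg =>
    obtain ⟨Q, hQ⟩ := hf
    obtain ⟨Q', hQ'⟩ := hg
    refine ⟨Q + Q', fun x => ⟨by simp [(hQ x).1, (hQ' x).1], fun y => ?_⟩⟩
    simp [QuadraticMap.polar_add, (hQ x).2, (hQ' x).2, add_mul, Finset.sum_add_distrib]
  | smul c f _ hf =>
    obtain ⟨Q, hQ⟩ := hf
    refine ⟨c • Q, fun x => ⟨by simp [(hQ x).1], fun y => ?_⟩⟩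
    simp [QuadraticMap.polar_smul, (hQ x).2, mul_assoc, Finset.mul_sum]

end QuadraticForms

section LinearChange

open MvPolynomial

variable {k : Type*} [Field k] [Infinite k]

/-- Substitution of linear forms. -/
noncomputable def linearSubst (M : (Fin 4 → k) →ₗ[k] (Fin 4 → k)) :
    MvPolynomial (Fin 4) k →ₐ[k] MvPolynomial (Fin 4) k :=
  aeval fun i => ∑ j, C (M (Pi.single j 1) i) * X j

omit [Infinite k] in
theorem eval_linearSubst (M : (Fin 4 → k) →ₗ[k] (Fin 4 → k)) (x : Fin 4 → k)
    (f : MvPolynomial (Fin 4) k) : eval x (linearSubst M f) = eval (M x) f := by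
  induction f using MvPolynomial.induction_on with
  | C c => rw [linearSubst, algHom_C]; simp
  | add f g hf hg => simp [hf, hg]
  | mul_X f i hf =>
    have hx : M x i = ∑ j, x j * M (Pi.single j 1) i := by
      conv_lhs => rw [pi_eq_sum_univ' x]
      simp
    rw [map_mul, map_mul, map_mul, hf, linearSubst, aeval_X, eval_X, hx]
    simp [mul_comm]

/-- Invertible linear substitutions. -/
noncomputable def linearSubstEquiv (M : (Fin 4 → k) ≃ₗ[k] (Fin 4 → k)) :
    MvPolynomial (Fin 4) k ≃ₐ[k] MvPolynomial (Fin 4) k :=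
  AlgEquiv.ofAlgHom (linearSubst M.toLinearMap) (linearSubst M.symm.toLinearMap)
    (AlgHom.ext fun f => MvPolynomial.funext fun x => by simp [eval_linearSubst])
    (AlgHom.ext fun f => MvPolynomial.funext fun x => by simp [eval_linearSubst])

omit [Infinite k] in
theorem map_linearSubst_powIdeal_le {p : ℕ} [Fact p.Prime] [CharP k p] (e : ℕ)
    (M : (Fin 4 → k) →ₗ[k] (Fin 4 → k)) :
    (powIdeal k (p ^ e)).map (linearSubst M) ≤ powIdeal k (p ^ e) := by
  rw [Ideal.map_le_iff_le_comap, powIdeal, Ideal.span_le]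
  rintro _ ⟨i, rfl⟩
  simp only [SetLike.mem_coe, Ideal.mem_comap, map_pow, linearSubst, aeval_X, sum_pow_char_pow,
    mul_pow]
  exact Ideal.sum_mem _ fun j _ => Ideal.mul_mem_left _ _ (Ideal.subset_span ⟨j, rfl⟩)

theorem map_linearSubstEquiv_powIdeal {p : ℕ} [Fact p.Prime] [CharP k p] (e : ℕ)
    (M : (Fin 4 → k) ≃ₗ[k] (Fin 4 → k)) :
    (powIdeal k (p ^ e)).map (linearSubstEquiv M) = powIdeal k (p ^ e) := by
  refine le_antisymm (map_linearSubst_powIdeal_le e _) ?_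
  have h := Ideal.map_mono (f := linearSubstEquiv M)
    (map_linearSubst_powIdeal_le (p := p) e M.symm.toLinearMap)
  refine le_trans (le_of_eq ?_) h
  exact (Ideal.map_of_equiv (linearSubstEquiv M).symm.toRingEquiv).symm

theorem finrank_quotient_eq_of_pencil {p : ℕ} [Fact p.Prime] [CharP k p] (e : ℕ)
    (M : (Fin 4 → k) ≃ₗ[k] (Fin 4 → k)) {a b c d : k} (hdet : a * d - b * c ≠ 0)
    {f g f' g' : MvPolynomial (Fin 4) k}
    (hf : ∀ x, eval x f' = a * eval (M x) f + b * eval (M x) g)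
    (hg : ∀ x, eval x g' = c * eval (M x) f + d * eval (M x) g) :
    Module.finrank k (MvPolynomial (Fin 4) k ⧸ Ideal.span {f, g} ⊔ powIdeal k (p ^ e)) =
      Module.finrank k (MvPolynomial (Fin 4) k ⧸ Ideal.span {f', g'} ⊔ powIdeal k (p ^ e)) := by
  refine (Ideal.quotientEquivAlg _ _ (linearSubstEquiv M) ?_).toLinearEquiv.finrank_eq
  rw [Ideal.map_sup]
  congr 1
  swap
  · exact (map_linearSubstEquiv_powIdeal e M).symm
  have hf' : f' = C a * linearSubstEquiv M f + C b * linearSubstEquiv M g :=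
    MvPolynomial.funext fun x => by
      rw [hf, map_add, map_mul, map_mul, eval_C, eval_C]
      simp [linearSubstEquiv, eval_linearSubst]
  have hg' : g' = C c * linearSubstEquiv M f + C d * linearSubstEquiv M g :=
    MvPolynomial.funext fun x => by
      rw [hg, map_add, map_mul, map_mul, eval_C, eval_C]
      simp [linearSubstEquiv, eval_linearSubst]
  have hC : C (a * d - b * c)⁻¹ * (C a * C d - C b * C c) = (1 : MvPolynomial (Fin 4) k) := by
    rw [← C_mul, ← C_mul, ← C_sub, ← C_mul, inv_mul_cancel₀ hdet, C_1]
  have hmap : Ideal.map (linearSubstEquiv M : MvPolynomial (Fin 4) k →+* _) (Ideal.span {f, g}) =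
      Ideal.span {linearSubstEquiv M f, linearSubstEquiv M g} := by
    rw [Ideal.map_span, Set.image_pair]; rfl
  refine Eq.trans ?_ hmap.symm
  generalize linearSubstEquiv M f = F at *
  generalize linearSubstEquiv M g = G at *
  apply le_antisymm <;> refine Ideal.span_le.2 ?_ <;> rintro x (hx | hx)
  · exact Ideal.mem_span_pair.2 ⟨_, _, (hx.trans hf').symm⟩
  · exact Ideal.mem_span_pair.2 ⟨_, _, (Set.mem_singleton_iff.1 hx |>.trans hg').symm⟩
  · refine Ideal.mem_span_pair.2 ⟨C (a * d - b * c)⁻¹ * C d, -C (a * d - b * c)⁻¹ * C b, ?_⟩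
    rw [hf', hg', hx]
    linear_combination F * hC
  · refine Ideal.mem_span_pair.2 ⟨-C (a * d - b * c)⁻¹ * C c, C (a * d - b * c)⁻¹ * C a, ?_⟩
    rw [hf', hg', Set.mem_singleton_iff.1 hx]
    linear_combination G * hC

omit [Infinite k] in
theorem span_eq_sup_powIdeal (f g : MvPolynomial (Fin 4) k) (q : ℕ) :
    Ideal.span {f, g, X 0 ^ q, X 1 ^ q, X 2 ^ q, X 3 ^ q} = Ideal.span {f, g} ⊔ powIdeal k q := by
  rw [powIdeal, ← Ideal.span_union]
  congr 1
  ext x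
  simp [Fin.exists_fin_succ, eq_comm, or_assoc]

end LinearChange

section SingularMember

variable {k : Type*} [Field k] [IsAlgClosed k]

theorem exists_smul_polarBilin_apply_eq_zero {V : Type*} [AddCommGroup V] [Module k V]
    [FiniteDimensional k V] [Nontrivial V] (B B' : V →ₗ[k] Module.Dual k V) :
    ∃ a b : k, (a ≠ 0 ∨ b ≠ 0) ∧ ∃ v, v ≠ 0 ∧ a • B v + b • B' v = 0 := by
  by_cases hB : Function.Injective B'
  · let E := LinearEquiv.ofInjectiveOfFinrankEq B' hB (Subspace.dual_finrank_eq (K := k)).symm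
    obtain ⟨c, hc⟩ := Module.End.exists_eigenvalue (E.symm.toLinearMap ∘ₗ B)
    obtain ⟨v, hv⟩ := hc.exists_hasEigenvector
    refine ⟨1, -c, Or.inl one_ne_zero, v, hv.2, ?_⟩
    have h := congrArg E hv.apply_eq_smul
    simp only [LinearMap.comp_apply, LinearEquiv.coe_coe, LinearEquiv.apply_symm_apply,
      map_smul] at h
    rw [h, one_smul]
    have hE : E v = B' v := rfl
    refine LinearMap.ext fun y => ?_
    simp [hE]
  · rw [injective_iff_map_eq_zero] at hB
    push Not at hB
    obtain ⟨v, hv, hv0⟩ := hB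
    exact ⟨0, 1, Or.inr one_ne_zero, v, hv0, by simp [hv]⟩

omit [IsAlgClosed k] in
/-- An alternating form in four variables with a nonzero radical vector has a two-dimensional
radical. -/
theorem exists_radical_of_alternating {B : (Fin 4 → k) →ₗ[k] Module.Dual k (Fin 4 → k)}
    (hB : ∀ x, B x x = 0) (hB' : ∀ x y, B x y = -B y x) {v : Fin 4 → k} (hv : v ≠ 0)
    (hBv : B v = 0) : ∃ w, B w = 0 ∧ ∀ c : k, w ≠ c • v := by
  obtain ⟨i, hi⟩ := Function.ne_iff.1 hv
  rw [Pi.zero_apply] at hi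
  let e : Fin 3 → Fin 4 → k := fun j => Pi.single (i.succAbove j) 1
  have hspan : ∀ w : Fin 4 → k, (∀ j, B w (e j) = 0) → B w = 0 := by
    intro w hw
    refine LinearMap.ext fun y => ?_
    have hy : y = (y i / v i) • v +
        ∑ j, (y (i.succAbove j) - y i / v i * v (i.succAbove j)) • e j := by
      ext l
      rcases eq_or_ne l i with rfl | hl
      · simp [e, hi, Finset.sum_apply]
      · obtain ⟨j, rfl⟩ := Fin.exists_succAbove_eq hl
        simp [e, Finset.sum_apply, Pi.single_apply]
    have h1 : B w v = 0 := by rw [hB', hBv]; simp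
    rw [hy, map_add, map_smul, h1, map_sum]
    simp [hw]
  have hne : ∀ w : Fin 4 → k, w i = 0 → w ≠ 0 → ∀ c : k, w ≠ c • v := by
    rintro _ hwi hw c rfl
    rcases mul_eq_zero.1 hwi with rfl | h
    · simp at hw
    · exact hi h
  have hei : ∀ j, e j i = 0 := fun j => by simp [e]
  by_cases h : B (e 0) (e 1) = 0 ∧ B (e 0) (e 2) = 0
  · refine ⟨e 0, hspan _ fun j => ?_, hne _ (hei 0) ?_⟩
    · fin_cases j
      exacts [hB _, h.1, h.2]
    · simp [e]
  · refine ⟨B (e 1) (e 2) • e 0 - B (e 0) (e 2) • e 1 + B (e 0) (e 1) • e 2,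
      hspan _ fun j => ?_, hne _ (by simp [hei]) fun h0 => h ?_⟩
    · fin_cases j
      · simp [hB, hB' (e 1) (e 0), hB' (e 2) (e 0)]; ring
      · simp [hB, hB' (e 2) (e 1)]; ring
      · simp [hB]; ring
    · have h1 := congrFun h0 (i.succAbove 1)
      have h2 := congrFun h0 (i.succAbove 2)
      simp [e] at h1 h2
      exact ⟨h2, h1⟩

theorem exists_singular_member (F G : QuadraticForm k (Fin 4 → k)) :
    ∃ a b : k, (a ≠ 0 ∨ b ≠ 0) ∧ ∃ v, v ≠ 0 ∧ (a • F + b • G) v = 0 ∧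
      ∀ y, QuadraticMap.polar (a • F + b • G) v y = 0 := by
  obtain ⟨a, b, hab, v, hv, h⟩ :=
    exists_smul_polarBilin_apply_eq_zero F.polarBilin G.polarBilin
  refine ⟨a, b, hab, ?_⟩
  set H := a • F + b • G with hH
  have hHv : H.polarBilin v = 0 := by
    rw [← h]
    refine LinearMap.ext fun y => ?_
    simp [hH, QuadraticMap.polar_add, QuadraticMap.polar_smul]
  have hpol : ∀ w, H.polarBilin w = 0 → ∀ y, QuadraticMap.polar H w y = 0 :=
    fun w hw y => LinearMap.congr_fun hw y
  by_cases h2 : (2 : k) = 0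
  · obtain ⟨w, hw, hwv⟩ := exists_radical_of_alternating (B := H.polarBilin)
      (fun x => by simp [h2]) (fun x y => by
        rw [eq_neg_iff_add_eq_zero, QuadraticMap.polarBilin_apply_apply,
          QuadraticMap.polarBilin_apply_apply, QuadraticMap.polar_comm, ← two_mul, h2, zero_mul])
      hv hHv
    by_cases hv0 : H v = 0
    · exact ⟨v, hv, hv0, hpol v hHv⟩
    obtain ⟨c, hc⟩ := IsAlgClosed.exists_pow_nat_eq (-H w / H v) (n := 2) two_pos
    refine ⟨w + c • v, fun h0 => hwv (-c) ?_, ?_, hpol _ (by simp [hw, hHv])⟩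
    · rw [neg_smul, eq_neg_iff_add_eq_zero, h0]
    · rw [QuadraticMap.map_add (⇑H), hpol w hw, QuadraticMap.map_smul, ← pow_two, hc]
      simp [hv0]
  · refine ⟨v, hv, ?_, hpol v hHv⟩
    have := hpol v hHv v
    rw [QuadraticMap.polar_self] at this
    simpa [h2] using this

end SingularMember

section Pencils

open QuadraticMap (polar)

variable {k : Type*} [Field k]

/-- The Jacobian criterion for the intersection of two quadrics. -/
def SmoothPencil (F G : (Fin 4 → k) → k) : Prop :=
  ∀ v ≠ 0, F v = 0 → G v = 0 → ∀ s t : k, (∀ y, s * polar F v y + t * polar G v y = 0) →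
    s = 0 ∧ t = 0

/-- Equality of pencils of quadrics up to a linear change of coordinates. -/
def PencilEquiv (F G F' G' : (Fin 4 → k) → k) : Prop :=
  ∃ (M : (Fin 4 → k) ≃ₗ[k] (Fin 4 → k)) (a b c d : k), a * d - b * c ≠ 0 ∧
    (∀ x, F' x = a * F (M x) + b * G (M x)) ∧ ∀ x, G' x = c * F (M x) + d * G (M x)

theorem PencilEquiv.trans {F G F' G' F'' G'' : (Fin 4 → k) → k} (h : PencilEquiv F G F' G')
    (h' : PencilEquiv F' G' F'' G'') : PencilEquiv F G F'' G'' := by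
  obtain ⟨M, a, b, c, d, hdet, hF, hG⟩ := h
  obtain ⟨M', a', b', c', d', hdet', hF', hG'⟩ := h'
  refine ⟨M'.trans M, a' * a + b' * c, a' * b + b' * d, c' * a + d' * c, c' * b + d' * d, ?_,
    fun x => ?_, fun x => ?_⟩
  · convert mul_ne_zero hdet hdet' using 1
    ring
  · rw [hF', hF, hG, LinearEquiv.trans_apply]
    ring
  · rw [hG', hF, hG, LinearEquiv.trans_apply]
    ring

theorem eq_zero_of_linear_system {a b c d x y : k} (hdet : a * d - b * c ≠ 0)
    (h₁ : a * x + b * y = 0) (h₂ : c * x + d * y = 0) : x = 0 ∧ y = 0 := by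
  constructor
  · apply (mul_eq_zero.1 (?_ : (a * d - b * c) * x = 0)).resolve_left hdet
    linear_combination d * h₁ - b * h₂
  · apply (mul_eq_zero.1 (?_ : (a * d - b * c) * y = 0)).resolve_left hdet
    linear_combination a * h₂ - c * h₁

theorem SmoothPencil.of_pencilEquiv {F G F' G' : (Fin 4 → k) → k} (hs : SmoothPencil F G)
    (h : PencilEquiv F G F' G') : SmoothPencil F' G' := by
  obtain ⟨M, a, b, c, d, hdet, hF, hG⟩ := h
  intro v hv hFv hGv s t hst
  rw [hF] at hFv
  rw [hG] at hGv
  obtain ⟨h₁, h₂⟩ := eq_zero_of_linear_system hdet hFv hGv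
  have := hs (M v) (by simpa using hv) h₁ h₂ (a * s + c * t) (b * s + d * t) fun y => by
    have := hst (M.symm y)
    simp only [polar, hF, hG, map_add, LinearEquiv.apply_symm_apply] at this ⊢
    linear_combination this
  exact eq_zero_of_linear_system (by convert hdet using 1; ring) this.1 this.2

/-- The linear combination of four vectors. -/
def combination (e₀ e₁ e₂ e₃ : Fin 4 → k) : (Fin 4 → k) →ₗ[k] (Fin 4 → k) where
  toFun x := x 0 • e₀ + x 1 • e₁ + x 2 • e₂ + x 3 • e₃
  map_add' x y := by simp only [Pi.add_apply]; module
  map_smul' c x := by simp only [Pi.smul_apply, smul_eq_mul, RingHom.id_apply]; module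

theorem PencilEquiv.of_injective {F G F' G' : (Fin 4 → k) → k}
    (M : (Fin 4 → k) →ₗ[k] (Fin 4 → k)) (hM : ∀ x, M x = 0 → x = 0) {a b c d : k}
    (hdet : a * d - b * c ≠ 0) (hF : ∀ x, F' x = a * F (M x) + b * G (M x))
    (hG : ∀ x, G' x = c * F (M x) + d * G (M x)) : PencilEquiv F G F' G' :=
  ⟨LinearEquiv.ofInjectiveEndo M ((injective_iff_map_eq_zero M).2 hM), a, b, c, d, hdet,
    fun x => hF x, fun x => hG x⟩

theorem PencilEquiv.of_injective_symm {F G F' G' : (Fin 4 → k) → k}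
    (M : (Fin 4 → k) →ₗ[k] (Fin 4 → k)) (hM : ∀ x, M x = 0 → x = 0) {a b c d : k}
    (hdet : a * d - b * c ≠ 0) (hF : ∀ x, F' (M x) = a * F x + b * G x)
    (hG : ∀ x, G' (M x) = c * F x + d * G x) : PencilEquiv F G F' G' := by
  let E := LinearEquiv.ofInjectiveEndo M ((injective_iff_map_eq_zero M).2 hM)
  have hE : ∀ x, M (E.symm x) = x := fun x => E.apply_symm_apply x
  exact ⟨E.symm, a, b, c, d, hdet, fun x => by rw [← hF, hE], fun x => by rw [← hG, hE]⟩

theorem QuadraticForm.apply_combination (Q : QuadraticForm k (Fin 4 → k))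
    (e₀ e₁ e₂ e₃ x : Fin 4 → k) : Q (combination e₀ e₁ e₂ e₃ x) =
      x 0 ^ 2 * Q e₀ + x 1 ^ 2 * Q e₁ + x 2 ^ 2 * Q e₂ + x 3 ^ 2 * Q e₃ +
      x 0 * x 1 * polar Q e₀ e₁ + x 0 * x 2 * polar Q e₀ e₂ + x 0 * x 3 * polar Q e₀ e₃ +
      x 1 * x 2 * polar Q e₁ e₂ + x 1 * x 3 * polar Q e₁ e₃ + x 2 * x 3 * polar Q e₂ e₃ := by
  change Q (x 0 • e₀ + x 1 • e₁ + x 2 • e₂ + x 3 • e₃) = _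
  simp only [QuadraticMap.map_add (⇑Q), QuadraticMap.map_smul, QuadraticMap.polar_add_left,
    QuadraticMap.polar_smul_left, QuadraticMap.polar_smul_right, smul_eq_mul]
  ring

end Pencils

section HyperbolicBasis

open QuadraticMap (polar)

variable {k : Type*} [Field k]

theorem exists_ne_combination (e₀ e₁ e₂ : Fin 4 → k) :
    ∃ y : Fin 4 → k, ∀ r s t : k, y ≠ r • e₀ + s • e₁ + t • e₂ := by
  by_contra! h
  have hs : Function.Surjective (combination e₀ e₁ e₂ 0) := fun y => by
    obtain ⟨r, s, t, rfl⟩ := h y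
    exact ⟨![r, s, t, 0], by simp [combination]⟩
  have hi := LinearMap.injective_iff_surjective.2 hs
  have h0 : (Pi.single 3 1 : Fin 4 → k) = 0 := hi (by simp [combination])
  simpa using congrFun h0 3

theorem combination_injective_of_apply {h : QuadraticForm k (Fin 4 → k)}
    {e₀ e₁ v e₃ : Fin 4 → k} (hv : v ≠ 0)
    (hh : ∀ x, h (combination e₀ e₁ v e₃ x) = x 1 ^ 2 - x 0 * x 3) {x : Fin 4 → k}
    (hx : combination e₀ e₁ v e₃ x = 0) : x = 0 := by
  have h1 : ∀ y, h (combination e₀ e₁ v e₃ (x + y)) = h (combination e₀ e₁ v e₃ y) := fun y => by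
    rw [map_add, hx, zero_add]
  have h2 := hh x
  rw [hx, QuadraticMap.map_zero] at h2
  have h3 := h1 (Pi.single 0 1)
  have h4 := h1 (Pi.single 3 1)
  simp only [hh, Pi.add_apply] at h3 h4
  simp at h3 h4
  have hx3 : x 3 = 0 := by linear_combination -h2 - h3
  have hx0 : x 0 = 0 := by linear_combination -h2 - h4
  have hx1 : x 1 = 0 := by
    rw [hx3, mul_zero, sub_zero] at h2
    exact pow_eq_zero_iff two_ne_zero |>.1 h2.symm
  have hx2 : x 2 = 0 := by
    simp [combination, hx0, hx1, hx3] at hx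
    exact hx.resolve_right hv
  ext i
  fin_cases i <;> assumption

variable [IsAlgClosed k]

theorem exists_hyperbolic_basis {h : QuadraticForm k (Fin 4 → k)} {v O : Fin 4 → k}
    (hv : h v = 0) (hvp : ∀ y, polar h v y = 0)
    (hns : ∀ u, h u = 0 → (∀ y, polar h u y = 0) → ∃ c : k, u = c • v)
    (hO : h O = 0) (hOv : ∀ c : k, O ≠ c • v) :
    ∃ e₀ e₁, ∀ x, h (combination e₀ e₁ v O x) = x 1 ^ 2 - x 0 * x 3 := by
  have hvp' : ∀ y, polar h y v = 0 := fun y => by rw [QuadraticMap.polar_comm, hvp]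
  have hOO : polar h O O = 0 := by rw [QuadraticMap.polar_self, hO, smul_zero]
  obtain ⟨y, hy⟩ : ∃ y, polar h O y ≠ 0 := by
    by_contra! H
    obtain ⟨c, hc⟩ := hns O hO H
    exact hOv c hc
  obtain ⟨e', he'⟩ : ∃ e', polar h O e' = -1 :=
    ⟨-(polar h O y)⁻¹ • y, by rw [QuadraticMap.polar_smul_right, smul_eq_mul]; field_simp⟩
  obtain ⟨e₀, he₀, he₀O⟩ : ∃ e₀, h e₀ = 0 ∧ polar h O e₀ = -1 := by
    refine ⟨e' + h e' • O, ?_, ?_⟩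
    · rw [QuadraticMap.map_add (⇑h), QuadraticMap.map_smul, hO, QuadraticMap.polar_smul_right,
        QuadraticMap.polar_comm, he', smul_eq_mul, smul_eq_mul]
      ring
    · rw [QuadraticMap.polar_add_right, QuadraticMap.polar_smul_right, hOO, he', smul_zero,
        add_zero]
  have he₀O' : polar h e₀ O = -1 := by rw [QuadraticMap.polar_comm, he₀O]
  have hee : polar h e₀ e₀ = 0 := by rw [QuadraticMap.polar_self, he₀, smul_zero]
  obtain ⟨w, hw₀, hwO, hw⟩ : ∃ w, polar h e₀ w = 0 ∧ polar h O w = 0 ∧ h w ≠ 0 := by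
    by_contra! H
    have hproj : ∀ y, polar h e₀ (y + polar h O y • e₀ + polar h e₀ y • O) = 0 ∧
        polar h O (y + polar h O y • e₀ + polar h e₀ y • O) = 0 := fun y => by
      simp [QuadraticMap.polar_add_right, QuadraticMap.polar_smul_right, he₀O, he₀O', hOO, hee]
    have hU : ∀ w, polar h e₀ w = 0 → polar h O w = 0 → ∃ c : k, w = c • v := by
      refine fun w hw₀ hwO => hns w (H w hw₀ hwO) fun y => ?_
      obtain ⟨hy₀, hyO⟩ := hproj y
      have h1 := H _ hy₀ hyO
      have h2 := H (w + (y + polar h O y • e₀ + polar h e₀ y • O))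
        (by rw [QuadraticMap.polar_add_right, hw₀, hy₀, add_zero])
        (by rw [QuadraticMap.polar_add_right, hwO, hyO, add_zero])
      rw [QuadraticMap.map_add (⇑h), h1, H w hw₀ hwO] at h2
      simpa [QuadraticMap.polar_add_right, QuadraticMap.polar_smul_right,
        QuadraticMap.polar_comm h w, hw₀, hwO] using h2
    obtain ⟨y, hy⟩ := exists_ne_combination e₀ O v
    obtain ⟨c, hc⟩ := hU _ (hproj y).1 (hproj y).2
    refine hy (-polar h O y) (-polar h e₀ y) c ?_
    rw [← hc]
    module
  obtain ⟨c, hc⟩ := IsAlgClosed.exists_pow_nat_eq (h w)⁻¹ (n := 2) two_pos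
  refine ⟨e₀, c • w, fun x => ?_⟩
  rw [QuadraticForm.apply_combination, he₀, hv, hO, QuadraticMap.map_smul,
    hvp', hvp', hvp, he₀O', QuadraticMap.polar_smul_left, QuadraticMap.polar_smul_right,
    hw₀, QuadraticMap.polar_comm h w, hwO, ← pow_two, hc]
  simp [hw]
  ring

end HyperbolicBasis

section WeierstrassPencil

open QuadraticMap (polar)

variable {k : Type*} [Field k]

/-- A quadric cone. -/
def coneForm (x : Fin 4 → k) : k := x 1 ^ 2 - x 0 * x 3

/-- The quadric which cuts out a Weierstrass curve on the quadric cone. -/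
def weierstrassForm (a₁ a₂ a₃ a₄ a₆ : k) (x : Fin 4 → k) : k :=
  x 2 ^ 2 + a₁ * x 1 * x 2 + a₃ * x 0 * x 2 - x 1 * x 3 -
    (a₂ * x 1 ^ 2 + a₄ * x 0 * x 1 + a₆ * x 0 ^ 2)

section Roots

open Polynomial

variable [IsAlgClosed k]

theorem exists_quartic_root {a : k} (ha : a ≠ 0) (b c d e : k) :
    ∃ x, a * x ^ 4 + b * x ^ 3 + c * x ^ 2 + d * x + e = 0 := by
  obtain ⟨x, hx⟩ := IsAlgClosed.exists_root (C a * X ^ 4 + C b * X ^ 3 + C c * X ^ 2 + C d * X + C e)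
    (by rw [show degree _ = 4 by compute_degree!]; decide)
  exact ⟨x, by simpa using hx⟩

theorem exists_cubic_root (a b c : k) : ∃ x, x ^ 3 + a * x ^ 2 + b * x + c = 0 := by
  obtain ⟨x, hx⟩ := IsAlgClosed.exists_root (X ^ 3 + C a * X ^ 2 + C b * X + C c)
    (by rw [show degree _ = 3 by compute_degree!]; decide)
  exact ⟨x, by simpa using hx⟩

theorem exists_quadratic_root (a b : k) : ∃ x, x ^ 2 + a * x + b = 0 := by
  obtain ⟨x, hx⟩ := IsAlgClosed.exists_root (X ^ 2 + C a * X + C b)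
    (by rw [show degree _ = 2 by compute_degree!]; decide)
  exact ⟨x, by simpa using hx⟩

end Roots

variable [IsAlgClosed k]

theorem exists_isotropic (h : QuadraticForm k (Fin 4 → k)) (v : Fin 4 → k) :
    ∃ O, h O = 0 ∧ ∀ c : k, O ≠ c • v := by
  obtain ⟨u, hu⟩ := exists_ne_combination v 0 0
  obtain ⟨w, hw⟩ := exists_ne_combination u v 0
  by_cases h0 : h u = 0
  · exact ⟨u, h0, fun c hc => hu c 0 0 (by simp [hc])⟩
  obtain ⟨r, hr⟩ := exists_quadratic_root ((h u)⁻¹ * polar h u w) ((h u)⁻¹ * h w)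
  refine ⟨r • u + w, ?_, fun c hc => hw (-r) c 0 ?_⟩
  · rw [QuadraticMap.map_add (⇑h), QuadraticMap.map_smul, QuadraticMap.polar_smul_left,
      smul_eq_mul, smul_eq_mul]
    have h1 := mul_inv_cancel₀ h0
    linear_combination h u * hr - (r * polar h u w + h w) * h1
  · rw [← hc]
    module

/-- The base point of the Weierstrass form is a ramification point of the projection from the
vertex of the cone. -/
theorem exists_ramification_point {h g : QuadraticForm k (Fin 4 → k)} {e₀ e₁ v e₃ : Fin 4 → k}
    (hv : v ≠ 0) (hh : ∀ x, h (combination e₀ e₁ v e₃ x) = x 1 ^ 2 - x 0 * x 3) (hg : g v = 1) :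
    ∃ O, h O = 0 ∧ g O = 0 ∧ polar g v O = 0 ∧ ∀ c : k, O ≠ c • v := by
  let D (s t : k) : k :=
    (s ^ 2 * polar g e₀ v + s * t * polar g e₁ v + t ^ 2 * polar g v e₃) ^ 2 -
      4 * (s ^ 4 * g e₀ + s ^ 2 * t ^ 2 * g e₁ + t ^ 4 * g e₃ + s ^ 3 * t * polar g e₀ e₁ +
        s ^ 2 * t ^ 2 * polar g e₀ e₃ + s * t ^ 3 * polar g e₁ e₃)
  obtain ⟨s, t, hst, hD⟩ : ∃ s t, (s ≠ 0 ∨ t ≠ 0) ∧ D s t = 0 := by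
    by_cases h4 : polar g e₀ v ^ 2 - 4 * g e₀ = 0
    · exact ⟨1, 0, Or.inl one_ne_zero, by simpa [D] using h4⟩
    · obtain ⟨s, hs⟩ := exists_quartic_root h4
        (2 * polar g e₀ v * polar g e₁ v - 4 * polar g e₀ e₁)
        (polar g e₁ v ^ 2 + 2 * polar g e₀ v * polar g v e₃ - 4 * (g e₁ + polar g e₀ e₃))
        (2 * polar g e₁ v * polar g v e₃ - 4 * polar g e₁ e₃) (polar g v e₃ ^ 2 - 4 * g e₃)
      exact ⟨s, 1, Or.inr one_ne_zero, by simp only [D]; linear_combination hs⟩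
  obtain ⟨w, hw⟩ := exists_quadratic_root
    (s ^ 2 * polar g e₀ v + s * t * polar g e₁ v + t ^ 2 * polar g v e₃)
    (s ^ 4 * g e₀ + s ^ 2 * t ^ 2 * g e₁ + t ^ 4 * g e₃ + s ^ 3 * t * polar g e₀ e₁ +
        s ^ 2 * t ^ 2 * polar g e₀ e₃ + s * t ^ 3 * polar g e₁ e₃)
  refine ⟨combination e₀ e₁ v e₃ ![s ^ 2, s * t, w, t ^ 2], ?_, ?_, ?_, fun c hc => ?_⟩
  · rw [hh]
    simp
    ring
  · rw [QuadraticForm.apply_combination, hg]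
    simp
    linear_combination hw
  · have hp : polar g v (combination e₀ e₁ v e₃ ![s ^ 2, s * t, w, t ^ 2]) =
        s ^ 2 * polar g e₀ v + s * t * polar g e₁ v + t ^ 2 * polar g v e₃ + 2 * w := by
      simp [combination, QuadraticMap.polar_add_right, QuadraticMap.polar_smul_right,
        QuadraticMap.polar_self, hg, QuadraticMap.polar_comm g v e₀, QuadraticMap.polar_comm g v e₁]
      ring
    rw [hp]
    apply (pow_eq_zero_iff (n := 2) two_ne_zero).1
    linear_combination 4 * hw + hD
  · have h0 := combination_injective_of_apply hv hh (x := ![s ^ 2, s * t, w - c, t ^ 2]) (by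
      simp [combination] at hc ⊢
      rw [← sub_eq_zero] at hc
      rw [← hc]
      module)
    have hs := congrFun h0 0
    have ht := congrFun h0 3
    simp at hs ht
    exact hst.elim (fun h => h hs) fun h => h ht

theorem SmoothPencil.exists_cone {F G : QuadraticForm k (Fin 4 → k)} (hs : SmoothPencil F G) :
    ∃ (h g : QuadraticForm k (Fin 4 → k)) (v : Fin 4 → k), v ≠ 0 ∧ h v = 0 ∧
      (∀ y, polar h v y = 0) ∧ g v = 1 ∧ PencilEquiv F G h g := by
  obtain ⟨a, b, hab, v, hv, hhv, hpol⟩ := exists_singular_member F G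
  have hFG : ¬(F v = 0 ∧ G v = 0) := fun ⟨hF, hG⟩ => by
    obtain ⟨rfl, rfl⟩ := hs v hv hF hG a b fun y => by
      simpa [QuadraticMap.polar_add, QuadraticMap.polar_smul] using hpol y
    simp at hab
  simp only [add_apply, smul_apply, smul_eq_mul] at hhv
  by_cases ha : a = 0
  · subst ha
    have hb : b ≠ 0 := by simpa using hab
    have hF : F v ≠ 0 := fun hF => hFG ⟨hF, by simpa [hb] using hhv⟩
    refine ⟨_, (F v)⁻¹ • F, v, hv, by simpa using hhv, hpol, by simp [hF],
      LinearEquiv.refl k _, 0, b, (F v)⁻¹, 0, by simp [hb, hF], fun x => by simp, fun x => by simp⟩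
  · have hG : G v ≠ 0 := fun hG => hFG ⟨by simpa [ha, hG] using hhv, hG⟩
    exact ⟨_, (G v)⁻¹ • G, v, hv, by simpa using hhv, hpol, by simp [hG],
      LinearEquiv.refl k _, a, b, 0, (G v)⁻¹, by simp [ha, hG], fun x => by simp, fun x => by simp⟩

theorem SmoothPencil.vertex_unique {h g : QuadraticForm k (Fin 4 → k)} (hs : SmoothPencil h g)
    {v : Fin 4 → k} (hvp : ∀ y, polar h v y = 0) (hv : h v = 0)
    (hg : g v = 1) {u : Fin 4 → k} (hu : h u = 0) (hup : ∀ y, polar h u y = 0) :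
    ∃ c : k, u = c • v := by
  obtain ⟨r, hr⟩ := exists_quadratic_root (polar g u v) (g u)
  refine ⟨-r, ?_⟩
  by_contra hc
  have hw : u + r • v ≠ 0 := fun h0 => hc (by rw [neg_smul, eq_neg_iff_add_eq_zero, h0])
  refine one_ne_zero (hs _ hw ?_ ?_ 1 0 fun y => ?_).1
  · rw [QuadraticMap.map_add (⇑h), hu, hup, QuadraticMap.map_smul, hv]
    simp
  · rw [QuadraticMap.map_add (⇑g), QuadraticMap.map_smul, hg, QuadraticMap.polar_smul_right,
      smul_eq_mul, smul_eq_mul]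
    linear_combination hr
  · simp [QuadraticMap.polar_add_left, QuadraticMap.polar_smul_left, hup, hvp]

theorem SmoothPencil.exists_weierstrass {F G : QuadraticForm k (Fin 4 → k)}
    (hs : SmoothPencil F G) :
    ∃ a₁ a₂ a₃ a₄ a₆ : k, PencilEquiv F G coneForm (weierstrassForm a₁ a₂ a₃ a₄ a₆) := by
  obtain ⟨h, g, v, hv0, hv, hvp, hg, hE⟩ := hs.exists_cone
  have hs' := hs.of_pencilEquiv hE
  obtain ⟨O, hO, hgO, hvO, hOv⟩ : ∃ O, h O = 0 ∧ g O = 0 ∧ polar g v O = 0 ∧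
      ∀ c : k, O ≠ c • v := by
    obtain ⟨O, hO, hOv⟩ := exists_isotropic h v
    obtain ⟨e₀, e₁, he⟩ := exists_hyperbolic_basis hv hvp
      (fun u hu hup => hs'.vertex_unique hvp hv hg hu hup) hO hOv
    exact exists_ramification_point hv0 he hg
  obtain ⟨e₀, e₁, he⟩ := exists_hyperbolic_basis hv hvp
    (fun u hu hup => hs'.vertex_unique hvp hv hg hu hup) hO hOv
  set γ := polar g e₁ O with hγ
  have hE' : PencilEquiv h g coneForm fun x => x 0 ^ 2 * g e₀ +
      x 1 ^ 2 * (g e₁ + polar g e₀ O) + x 2 ^ 2 + x 0 * x 1 * polar g e₀ e₁ +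
      x 0 * x 2 * polar g e₀ v + x 1 * x 2 * polar g e₁ v + x 1 * x 3 * γ := by
    refine PencilEquiv.of_injective (combination e₀ e₁ v O)
      (fun x hx => combination_injective_of_apply hv0 he hx)
      (a := 1) (b := 0) (c := polar g e₀ O) (d := 1) (by simp) (fun x => ?_) fun x => ?_
    · rw [he, coneForm]; ring
    · rw [he, QuadraticForm.apply_combination, hg, hgO, hvO]; ring
  have hγ0 : γ ≠ 0 := fun hγ0 => by
    refine one_ne_zero (hs'.of_pencilEquiv hE' (Pi.single 3 1) (by simp) ?_ ?_ 0 1 fun y => ?_).2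
    · simp [coneForm]
    · simp
    · simp [polar, hγ0]
  refine ⟨polar g e₁ v, -(g e₁ + polar g e₀ O), -γ * polar g e₀ v, γ * polar g e₀ e₁,
    -γ ^ 2 * g e₀, hE.trans (hE'.trans ?_)⟩
  refine PencilEquiv.of_injective
    (combination ![-γ, 0, 0, 0] ![0, 1, 0, 0] ![0, 0, 1, 0] ![0, 0, 0, -γ⁻¹]) (fun x hx => ?_)
    (a := 1) (b := 0) (c := 0) (d := 1) (by simp) (fun x => ?_) fun x => ?_
  · ext i
    have hi := congrFun hx i
    fin_cases i <;> simpa [combination, hγ0] using hi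
  · simp [combination, coneForm]
    field_simp
  · simp [combination, weierstrassForm]
    field_simp
    ring

end WeierstrassPencil

section NormalForms

open QuadraticMap (polar)

variable {k : Type*} [Field k]

theorem pencilEquiv_weierstrassForm (a₁ a₂ a₃ a₄ a₆ r s t : k) :
    PencilEquiv coneForm (weierstrassForm a₁ a₂ a₃ a₄ a₆) coneForm
      (weierstrassForm (a₁ + 2 * s) (a₂ - s * a₁ + 3 * r - s ^ 2) (a₃ + r * a₁ + 2 * t)
        (a₄ - s * a₃ + 2 * r * a₂ - (t + r * s) * a₁ + 3 * r ^ 2 - 2 * s * t)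
        (a₆ + r * a₄ + r ^ 2 * a₂ + r ^ 3 - t * a₃ - t ^ 2 - r * t * a₁)) := by
  refine PencilEquiv.of_injective
    (combination ![1, r, t, r ^ 2] ![0, 1, s, 2 * r] ![0, 0, 1, 0] ![0, 0, 0, 1])
    (fun x hx => ?_) (a := 1) (b := 0) (c := -r) (d := 1) (by simp) (fun x => ?_) fun x => ?_
  · have h0 := congrFun hx 0
    have h1 := congrFun hx 1
    have h2 := congrFun hx 2
    have h3 := congrFun hx 3
    simp [combination] at h0 h1 h2 h3
    simp only [h0, zero_mul, zero_add] at h1 h2 h3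
    simp only [h1, zero_mul, zero_add] at h2 h3
    ext i
    fin_cases i <;> assumption
  · simp [combination, coneForm]
    ring
  · simp [combination, coneForm, weierstrassForm]
    ring

theorem SmoothPencil.not_singular {a₁ a₂ a₃ a₄ a₆ : k}
    (hs : SmoothPencil coneForm (weierstrassForm a₁ a₂ a₃ a₄ a₆)) (x y s : k)
    (h : y ^ 2 + a₁ * x * y + a₃ * y = x ^ 3 + a₂ * x ^ 2 + a₄ * x + a₆)
    (h₀ : a₃ * y - a₄ * x - 2 * a₆ = s * x ^ 2)
    (h₁ : a₁ * y - x ^ 2 - 2 * a₂ * x - a₄ = -2 * s * x)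
    (h₂ : 2 * y + a₁ * x + a₃ = 0) (h₃ : x = -s) : False := by
  refine one_ne_zero (hs ![1, x, y, x ^ 2] (fun h0 => ?_) ?_ ?_ s 1 fun z => ?_).2
  · simpa using congrFun h0 0
  · simp [coneForm]
  · simp [weierstrassForm]
    linear_combination h
  · simp [polar, coneForm, weierstrassForm]
    linear_combination z 0 * h₀ + z 1 * h₁ + z 2 * h₂ - z 3 * h₃

variable [IsAlgClosed k]

theorem SmoothPencil.exists_cubicForm {a₁ a₂ a₃ a₄ a₆ : k} (h3 : (3 : k) ≠ 0)
    (hs : SmoothPencil coneForm (weierstrassForm a₁ a₂ a₃ a₄ a₆)) :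
    ∃ b₁ b₃ : k, b₁ ^ 3 ≠ 27 * b₃ ∧ b₃ ≠ 0 ∧
      PencilEquiv coneForm (weierstrassForm a₁ a₂ a₃ a₄ a₆) (fun x => x 2 ^ 2 - x 0 * x 1)
        fun x => x 3 ^ 2 + b₁ * x 2 * x 3 + b₃ * x 0 * x 3 - x 1 * x 2 := by
  obtain ⟨r, hr⟩ := exists_quartic_root h3 (a₁ ^ 2 + 4 * a₂) (3 * (2 * a₄ + a₁ * a₃))
    (3 * (a₃ ^ 2 + 4 * a₆)) (a₁ ^ 2 * a₆ + 4 * a₂ * a₆ - a₁ * a₃ * a₄ + a₂ * a₃ ^ 2 - a₄ ^ 2)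
  obtain ⟨t, ht⟩ := exists_quadratic_root (a₃ + r * a₁) (-(a₆ + r * a₄ + r ^ 2 * a₂ + r ^ 3))
  obtain ⟨c₁, c₂, c₃, c₄, hb8, hE⟩ : ∃ c₁ c₂ c₃ c₄ : k,
      c₂ * c₃ ^ 2 - c₁ * c₃ * c₄ - c₄ ^ 2 = 0 ∧
      PencilEquiv coneForm (weierstrassForm a₁ a₂ a₃ a₄ a₆) coneForm
        (weierstrassForm c₁ c₂ c₃ c₄ 0) := by
    have hW := pencilEquiv_weierstrassForm a₁ a₂ a₃ a₄ a₆ r 0 t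
    have h₆ : a₆ + r * a₄ + r ^ 2 * a₂ + r ^ 3 - t * a₃ - t ^ 2 - r * t * a₁ = 0 := by
      linear_combination -ht
    rw [h₆] at hW
    refine ⟨_, _, _, _, ?_, hW⟩
    linear_combination hr + (a₁ ^ 2 + 4 * a₂ + 12 * r) * ht
  clear hr ht
  have hs' := hs.of_pencilEquiv hE
  have hc₃ : c₃ ≠ 0 := by
    rintro rfl
    obtain rfl : c₄ = 0 := by simpa using hb8
    exact hs'.not_singular 0 0 0 (by ring) (by ring) (by ring) (by ring) (by ring)
  have hE' : PencilEquiv coneForm (weierstrassForm c₁ c₂ c₃ c₄ 0) coneForm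
      (weierstrassForm (c₁ + 2 * (c₄ / c₃)) 0 c₃ 0 0) := by
    convert pencilEquiv_weierstrassForm c₁ c₂ c₃ c₄ 0 0 (c₄ / c₃) 0 using 2
    · field_simp
      linear_combination -hb8
    · ring
    · field_simp
      ring
    · ring
  generalize c₁ + 2 * (c₄ / c₃) = b₁ at hE'
  refine ⟨b₁, c₃, fun h27 => ?_, hc₃, hE.trans (hE'.trans ?_)⟩
  · obtain ⟨c, rfl⟩ : ∃ c, b₁ = 3 * c := ⟨b₁ / 3, by field_simp⟩
    obtain rfl : c₃ = c ^ 3 := by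
      have h27' : (27 : k) ≠ 0 := by
        rw [show (27 : k) = 3 ^ 3 by norm_num]
        exact pow_ne_zero _ h3
      apply mul_left_cancel₀ h27'
      linear_combination -h27
    exact (hs'.of_pencilEquiv hE').not_singular (-c ^ 2) (c ^ 3) (c ^ 2) (by ring) (by ring)
      (by ring) (by ring) (by ring)
  · refine PencilEquiv.of_injective
      (combination ![1, 0, 0, 0] ![0, 0, 0, 1] ![0, 1, 0, 0] ![0, 0, 1, 0])
      (fun x hx => ?_) (a := 1) (b := 0) (c := 0) (d := 1) (by simp) (fun x => ?_) fun x => ?_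
    · have h0 := congrFun hx 0
      have h1 := congrFun hx 1
      have h2 := congrFun hx 2
      have h3 := congrFun hx 3
      simp [combination] at h0 h1 h2 h3
      ext i
      fin_cases i <;> assumption
    · simp [combination, coneForm]
    · simp [combination, weierstrassForm]
      ring

theorem SmoothPencil.exists_diagonalForm {a₁ a₂ a₃ a₄ a₆ : k} (h3 : (3 : k) = 0)
    (hs : SmoothPencil coneForm (weierstrassForm a₁ a₂ a₃ a₄ a₆)) :
    ∃ μ ν : k, μ ≠ 0 ∧ ν ≠ 0 ∧ μ ≠ ν ∧
      PencilEquiv coneForm (weierstrassForm a₁ a₂ a₃ a₄ a₆)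
        (fun x => x 2 ^ 2 - (x 0 ^ 2 + μ * x 1 ^ 2)) fun x => x 3 ^ 2 - (x 0 ^ 2 + ν * x 1 ^ 2) := by
  have h2 : (2 : k) ≠ 0 := fun h2 => one_ne_zero (by linear_combination h3 - h2 : (1 : k) = 0)
  have h4 : (4 : k) ≠ 0 := by
    rw [show (4 : k) = 2 * 2 by norm_num]
    exact mul_ne_zero h2 h2
  obtain ⟨b₂, b₄, b₆, hE⟩ : ∃ b₂ b₄ b₆ : k,
      PencilEquiv coneForm (weierstrassForm a₁ a₂ a₃ a₄ a₆) coneForm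
        (weierstrassForm 0 b₂ 0 b₄ b₆) := by
    have hW := pencilEquiv_weierstrassForm a₁ a₂ a₃ a₄ a₆ 0 a₁ a₃
    have h₁ : a₁ + 2 * a₁ = 0 := by linear_combination a₁ * h3
    have h₃ : a₃ + 0 * a₁ + 2 * a₃ = 0 := by linear_combination a₃ * h3
    rw [h₁, h₃] at hW
    exact ⟨_, _, _, hW⟩
  obtain ⟨r, hr⟩ := exists_cubic_root b₂ b₄ b₆
  obtain ⟨c₂, c₄, hE'⟩ : ∃ c₂ c₄ : k,
      PencilEquiv coneForm (weierstrassForm 0 b₂ 0 b₄ b₆) coneForm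
        (weierstrassForm 0 c₂ 0 c₄ 0) := by
    have hW := pencilEquiv_weierstrassForm 0 b₂ 0 b₄ b₆ r 0 0
    have h₁ : (0 : k) + 2 * 0 = 0 := by ring
    have h₃ : 0 + r * 0 + 2 * 0 = 0 := by ring
    have h₆ : b₆ + r * b₄ + r ^ 2 * b₂ + r ^ 3 - 0 * 0 - 0 ^ 2 - r * 0 * 0 = 0 := by
      linear_combination hr
    rw [h₁, h₃, h₆] at hW
    exact ⟨_, _, hW⟩
  have hE'' := hE.trans hE'
  have hs' := hs.of_pencilEquiv hE''
  obtain ⟨α, hα⟩ := exists_quadratic_root c₂ c₄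
  obtain ⟨β, hβ⟩ : ∃ β, β = -c₂ - α := ⟨_, rfl⟩
  obtain rfl : c₂ = -(α + β) := by linear_combination hβ
  obtain rfl : c₄ = α * β := by linear_combination hα
  have hαβ : α * β ≠ 0 := fun h0 =>
    hs'.not_singular 0 0 0 (by ring) (by ring) (by linear_combination -h0) (by ring) (by ring)
  have hne : α ≠ β := by
    rintro rfl
    exact hs'.not_singular α 0 (-α) (by ring) (by ring) (by ring) (by ring) (by ring)
  refine ⟨-4 * α, -4 * β, ?_, ?_, ?_, hE''.trans ?_⟩
  · simpa [h4] using left_ne_zero_of_mul hαβ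
  · simpa [h4] using right_ne_zero_of_mul hαβ
  · simpa [h4] using hne
  refine PencilEquiv.of_injective_symm (combination ![-(α * β), 0, α * β, α * β]
    ![0, 0, -2 * α, -2 * β] ![0, 1, 0, 0] ![1, 0, 1, 1])
    (fun x hx => ?_) (a := -4 * (α * β)) (b := 4 * α) (c := -4 * (α * β)) (d := 4 * β) ?_
    (fun x => ?_) fun x => ?_
  · have h0 := congrFun hx 0
    have h1 := congrFun hx 1
    have h2' := congrFun hx 2
    have h3' := congrFun hx 3
    simp [combination] at h0 h1 h2' h3'
    have hx1 : x 1 = 0 := by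
      apply (mul_eq_zero.1 (?_ : 2 * (α - β) * x 1 = 0)).resolve_left
        (mul_ne_zero h2 (sub_ne_zero.2 hne))
      linear_combination h3' - h2'
    have hx0 : x 0 = 0 := by
      apply (mul_eq_zero.1 (?_ : 2 * (α * β) * x 0 = 0)).resolve_left (mul_ne_zero h2 hαβ)
      linear_combination h2' - h0 + 2 * α * hx1
    have hx3 : x 3 = 0 := by linear_combination h0 + α * β * hx0
    ext i
    fin_cases i <;> assumption
  · rw [show -4 * (α * β) * (4 * β) - 4 * α * (-4 * (α * β)) = 4 * 4 * (α * β) * (α - β) by ring]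
    exact mul_ne_zero (mul_ne_zero (mul_ne_zero h4 h4) hαβ) (sub_ne_zero.2 hne)
  · simp [combination, coneForm, weierstrassForm]
    ring
  · simp [combination, coneForm, weierstrassForm]
    ring

end NormalForms

open MvPolynomial Filter

theorem smoothPencil_of_jacobian {k : Type*} [Field k] {f g : MvPolynomial (Fin 4) k}
    {F G : QuadraticForm k (Fin 4 → k)}
    (hF : ∀ x, F x = eval x f ∧ ∀ y, QuadraticMap.polar F x y = ∑ i, eval x (pderiv i f) * y i)
    (hG : ∀ x, G x = eval x g ∧ ∀ y, QuadraticMap.polar G x y = ∑ i, eval x (pderiv i g) * y i)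
    (hsmooth : ∀ a : Fin 4 → k, a ≠ 0 → eval a f = 0 → eval a g = 0 →
      LinearIndependent k
        ![fun i : Fin 4 => eval a (pderiv i f), fun i : Fin 4 => eval a (pderiv i g)]) :
    SmoothPencil F G := by
  intro v hv hFv hGv s t hst
  refine LinearIndependent.pair_iff.1
    (hsmooth v hv ((hF v).1.symm.trans hFv) ((hG v).1.symm.trans hGv)) s t ?_
  ext i
  have := hst (Pi.single i 1)
  rw [(hF v).2, (hG v).2] at this
  simpa [Pi.single_apply] using this

theorem PencilEquiv.tendsto {k : Type*} [Field k] [Infinite k] {p : ℕ} [Fact p.Prime] [CharP k p]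
    {f g f' g' : MvPolynomial (Fin 4) k}
    (h : PencilEquiv (fun x => eval x f) (fun x => eval x g) (fun x => eval x f')
      fun x => eval x g') (hQ : IsGood p (Ideal.span {f', g'})) :
    Tendsto (fun e : ℕ => (Module.finrank k (MvPolynomial (Fin 4) k ⧸
        Ideal.span {f, g, X 0 ^ p ^ e, X 1 ^ p ^ e, X 2 ^ p ^ e, X 3 ^ p ^ e}) : ℝ) /
          (p : ℝ) ^ (2 * e)) atTop (nhds (8 / 3)) := by
  obtain ⟨M, a, b, c, d, hdet, hF, hG⟩ := h
  refine (tendsto_of_isGood (Fact.out : p.Prime).one_lt hQ).congr fun e => ?_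
  rw [← finrank_quotient_eq_of_pencil e M hdet hF hG, ← span_eq_sup_powIdeal]

/-- The Hilbert–Kunz multiplicity of the maximal ideal of the homogeneous coordinate ring
`k[X₀,X₁,X₂,X₃]/(f,g)` of a smooth complete intersection of two quadrics in `ℙ³`
(an elliptic curve of degree 4) over an algebraically closed field of characteristic
`p > 0` exists and equals `8/3`. -/
theorem hilbert_kunz_multiplicity_complete_intersection_quadrics
    (k : Type*) [Field k] [IsAlgClosed k] (p : ℕ) (hp : 0 < p) [CharP k p]
    (f g : MvPolynomial (Fin 4) k)
    (hf : f.IsHomogeneous 2) (hg : g.IsHomogeneous 2)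
    (hnonempty : ∃ a : Fin 4 → k, a ≠ 0 ∧ eval a f = 0 ∧ eval a g = 0)
    (hsmooth : ∀ a : Fin 4 → k, a ≠ 0 → eval a f = 0 → eval a g = 0 →
      LinearIndependent k
        ![fun i : Fin 4 => eval a (pderiv i f), fun i : Fin 4 => eval a (pderiv i g)]) :
    Tendsto
      (fun e : ℕ =>
        (Module.finrank k
            (MvPolynomial (Fin 4) k ⧸
              Ideal.span {f, g, X 0 ^ p ^ e, X 1 ^ p ^ e, X 2 ^ p ^ e, X 3 ^ p ^ e}) : ℝ) /
          (p : ℝ) ^ (2 * e))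
      atTop (nhds (8 / 3)) := by
  have hp' : p.Prime := (CharP.char_is_prime_or_zero k p).resolve_right hp.ne'
  have : Fact p.Prime := ⟨hp'⟩
  have : Infinite k := IsAlgClosed.instInfinite
  obtain ⟨F, hF⟩ := hf.exists_quadraticForm
  obtain ⟨G, hG⟩ := hg.exists_quadraticForm
  have hs := smoothPencil_of_jacobian hF hG hsmooth
  obtain ⟨a₁, a₂, a₃, a₄, a₆, hE⟩ := hs.exists_weierstrass
  have hs' := hs.of_pencilEquiv hE
  have hF' : ⇑F = fun x => eval x f := _root_.funext fun x => (hF x).1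
  have hG' : ⇑G = fun x => eval x g := _root_.funext fun x => (hG x).1
  rw [hF', hG'] at hE
  by_cases h3 : p = 3
  · subst h3
    obtain ⟨μ, ν, hμ, hν, hμν, hE'⟩ := hs'.exists_diagonalForm (CharP.cast_eq_zero k 3)
    refine PencilEquiv.tendsto (f' := X 2 ^ 2 - (X 0 ^ 2 + C μ * X 1 ^ 2))
      (g' := X 3 ^ 2 - (X 0 ^ 2 + C ν * X 1 ^ 2)) ?_ (isGood_diagonalIdeal hμ hν hμν)
    simpa using hE.trans hE'
  · have h3' : (3 : k) ≠ 0 := fun h0 => h3 <| (Nat.prime_dvd_prime_iff_eq hp' Nat.prime_three).1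
      ((CharP.cast_eq_zero_iff k p 3).1 (by exact_mod_cast h0))
    obtain ⟨b₁, b₃, h27, hb₃, hE'⟩ := hs'.exists_cubicForm h3'
    refine PencilEquiv.tendsto (f' := X 2 ^ 2 - X 0 * X 1)
      (g' := X 3 ^ 2 + C b₁ * X 2 * X 3 + C b₃ * X 0 * X 3 - X 1 * X 2) ?_
      (isGood_cubicIdeal hp' h3 h27 hb₃)
    simpa using hE.trans hE'
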